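/- The Poincaré polynomial of the ordered configuration space Conf_r(ℝ^n) of r points in ℝ^n, for n ≥ 2, is ∏_{j=1}^{r-1} (1 + j·t^{n-1}); in particular, the total dimension of its cohomology is r!. -/

import Mathlib

open CategoryTheory

/-- The singular chain complex of a topological space with real coefficients: the
alternating face map complex of the levelwise free `ℝ`-module on the singular
simplicial set. -/
noncomputable def singularChainComplex (X : Type) [TopologicalSpace X] :
    ChainComplex (ModuleCat ℝ) ℕ :=
  (AlgebraicTopology.alternatingFaceMapComplex (ModuleCat ℝ)).obj
    (TopCat.toSSet.obj (TopCat.of X) ⋙ ModuleCat.free ℝ)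

/-- The `k`-th Betti number data of a topological space: the rank (dimension) of the
`k`-th singular homology with real coefficients.  Over `ℝ` this agrees with the
dimension of the `k`-th cohomology. -/
noncomputable def bettiRank (X : Type) [TopologicalSpace X] (k : ℕ) : Cardinal :=
  Module.rank ℝ ((singularChainComplex X).homology k)

/-- The free real vector space on `m`-tuples of elements of `P`. -/
abbrev TupleChain (P : Type) (m : ℕ) : Type := (Fin m → P) →₀ ℝ

namespace TupleChain

variable {P Q : Type}

/-- The alternating sum of the faces of a tuple. -/
noncomputable def bdry (m : ℕ) : TupleChain P (m + 1) →ₗ[ℝ] TupleChain P m :=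
  ∑ i : Fin (m + 1), (-1 : ℝ) ^ (i : ℕ) • Finsupp.lmapDomain ℝ ℝ (fun v ↦ v ∘ i.succAbove)

/-- The cone with apex `b`. -/
noncomputable def cone (b : P) (m : ℕ) : TupleChain P m →ₗ[ℝ] TupleChain P (m + 1) :=
  Finsupp.lmapDomain ℝ ℝ (fun v ↦ (Fin.cons b v : Fin (m + 1) → P))

/-- The map induced by a map of vertices. -/
noncomputable def map (φ : P → Q) (m : ℕ) : TupleChain P m →ₗ[ℝ] TupleChain Q m :=
  Finsupp.lmapDomain ℝ ℝ (fun v ↦ φ ∘ v)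

lemma bdry_single {m : ℕ} (v : Fin (m + 1) → P) :
    bdry m (Finsupp.single v 1) =
      ∑ i : Fin (m + 1), (-1 : ℝ) ^ (i : ℕ) • Finsupp.single (v ∘ i.succAbove) 1 := by
  simp [bdry, LinearMap.sum_apply]

@[simp] lemma cone_single {m : ℕ} (b : P) (v : Fin m → P) :
    cone b m (Finsupp.single v 1) = Finsupp.single (Fin.cons b v : Fin (m + 1) → P) 1 := by
  simp [cone]

@[simp] lemma map_single {m : ℕ} (φ : P → Q) (v : Fin m → P) :
    map φ m (Finsupp.single v 1) = Finsupp.single (φ ∘ v) 1 := by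
  simp [map]

lemma bdry_cone {m : ℕ} (b : P) (c : TupleChain P (m + 1)) :
    bdry (m + 1) (cone b (m + 1) c) = c - cone b m (bdry m c) := by
  suffices h : bdry (m + 1) ∘ₗ cone b (m + 1) = LinearMap.id - cone b m ∘ₗ bdry m from
    LinearMap.congr_fun h c
  ext1 v
  ext1
  simp only [LinearMap.comp_apply, Finsupp.lsingle_apply, cone_single, bdry_single,
    LinearMap.sub_apply, LinearMap.id_apply, map_sum, map_smul]
  rw [Fin.sum_univ_succ, sub_eq_add_neg, ← Finset.sum_neg_distrib]
  congr 1
  · simp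
  · refine Finset.sum_congr rfl fun i _ ↦ ?_
    have : (Fin.cons b v : Fin (m + 2) → P) ∘ i.succ.succAbove
        = (Fin.cons b (v ∘ i.succAbove) : Fin (m + 1) → P) := by
      funext j
      refine Fin.cases ?_ (fun j ↦ ?_) j <;> simp
    rw [this, Fin.val_succ, pow_succ]
    simp

lemma bdry_cone_zero (b : P) (c : TupleChain P 0) : bdry 0 (cone b 0 c) = c := by
  suffices h : bdry 0 ∘ₗ cone b 0 = LinearMap.id from LinearMap.congr_fun h c
  ext1 v
  ext1
  simp only [LinearMap.comp_apply, Finsupp.lsingle_apply, cone_single, bdry_single,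
    LinearMap.id_apply]
  simp

lemma bdry_bdry {m : ℕ} (c : TupleChain P (m + 2)) : bdry m (bdry (m + 1) c) = 0 := by
  suffices h : ∀ m, bdry (P := P) m ∘ₗ bdry (m + 1) = 0 from LinearMap.congr_fun (h m) c
  intro m
  induction m with
  | zero =>
    ext1 v
    ext1
    simp only [LinearMap.comp_apply, Finsupp.lsingle_apply, LinearMap.zero_apply]
    rw [← Fin.cons_self_tail v, ← cone_single, bdry_cone, map_sub, bdry_cone_zero, sub_self]
  | succ m ih =>
    ext1 v
    ext1
    simp only [LinearMap.comp_apply, Finsupp.lsingle_apply, LinearMap.zero_apply]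
    rw [← Fin.cons_self_tail v, ← cone_single, bdry_cone, map_sub, bdry_cone]
    have := LinearMap.congr_fun ih (Finsupp.single (Fin.tail v) 1)
    simp only [LinearMap.comp_apply, LinearMap.zero_apply] at this
    rw [this, map_zero, sub_zero, sub_self]

lemma map_bdry {m : ℕ} (φ : P → Q) (c : TupleChain P (m + 1)) :
    map φ m (bdry m c) = bdry m (map φ (m + 1) c) := by
  suffices h : map φ m ∘ₗ bdry m = bdry m ∘ₗ map φ (m + 1) from LinearMap.congr_fun h c
  ext1 v
  ext1
  simp only [LinearMap.comp_apply, Finsupp.lsingle_apply, map_single, bdry_single, map_sum,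
    map_smul, Function.comp_assoc]

lemma map_cone {m : ℕ} (φ : P → Q) (b : P) (c : TupleChain P m) :
    map φ (m + 1) (cone b m c) = cone (φ b) m (map φ m c) := by
  suffices h : map φ (m + 1) ∘ₗ cone b m = cone (φ b) m ∘ₗ map φ m from LinearMap.congr_fun h c
  ext1 v
  ext1
  simp only [LinearMap.comp_apply, Finsupp.lsingle_apply, cone_single, map_single]
  congr 1
  exact (Fin.comp_cons φ b v)

/-- The subdivision operator determined by a choice of apex for every nonempty tuple. -/
noncomputable def sd (β : ∀ m, (Fin (m + 1) → P) → P) : ∀ m, TupleChain P m →ₗ[ℝ] TupleChain P m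
  | 0 => LinearMap.id
  | m + 1 => Finsupp.linearCombination ℝ
      fun v ↦ cone (β m v) m (sd β m (bdry m (Finsupp.single v 1)))

/-- The chain homotopy between the identity and the subdivision operator. -/
noncomputable def sdHtpy (β : ∀ m, (Fin (m + 1) → P) → P) :
    ∀ m, TupleChain P m →ₗ[ℝ] TupleChain P (m + 1)
  | 0 => 0
  | m + 1 => Finsupp.linearCombination ℝ
      fun v ↦ cone (β m v) (m + 1)
        (Finsupp.single v 1 - sdHtpy β m (bdry m (Finsupp.single v 1)))

variable (β : ∀ m, (Fin (m + 1) → P) → P) (β' : ∀ m, (Fin (m + 1) → Q) → Q)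

lemma sd_single {m : ℕ} (v : Fin (m + 1) → P) :
    sd β (m + 1) (Finsupp.single v 1) =
      cone (β m v) m (sd β m (bdry m (Finsupp.single v 1))) := by
  simp [sd]

lemma sdHtpy_single {m : ℕ} (v : Fin (m + 1) → P) :
    sdHtpy β (m + 1) (Finsupp.single v 1) = cone (β m v) (m + 1)
        (Finsupp.single v 1 - sdHtpy β m (bdry m (Finsupp.single v 1))) := by
  simp [sdHtpy]

lemma bdry_sd {m : ℕ} (c : TupleChain P (m + 1)) :
    bdry m (sd β (m + 1) c) = sd β m (bdry m c) := by
  suffices h : ∀ m, bdry m ∘ₗ sd β (m + 1) = sd β m ∘ₗ bdry m from LinearMap.congr_fun (h m) c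
  intro m
  induction m with
  | zero =>
    ext1 v
    ext1
    simp only [LinearMap.comp_apply, Finsupp.lsingle_apply, sd_single, bdry_cone_zero]
  | succ m ih =>
    ext1 v
    ext1
    have := LinearMap.congr_fun ih (bdry (m + 1) (Finsupp.single v 1))
    simp only [LinearMap.comp_apply, bdry_bdry, map_zero] at this
    simp only [LinearMap.comp_apply, Finsupp.lsingle_apply, sd_single, bdry_cone, this, map_zero,
      sub_zero]

lemma bdry_sdHtpy {m : ℕ} (c : TupleChain P (m + 1)) :
    bdry (m + 1) (sdHtpy β (m + 1) c) + sdHtpy β m (bdry m c) = c - sd β (m + 1) c := by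
  suffices h : ∀ m, bdry (m + 1) ∘ₗ sdHtpy β (m + 1) + sdHtpy β m ∘ₗ bdry m
    = LinearMap.id - sd β (m + 1) from LinearMap.congr_fun (h m) c
  intro m
  induction m with
  | zero =>
    ext1 v
    ext1
    simp only [LinearMap.add_apply, LinearMap.comp_apply, Finsupp.lsingle_apply, sdHtpy_single,
      bdry_cone, LinearMap.sub_apply, LinearMap.id_apply, sd_single]
    simp [sdHtpy, sd]
  | succ m ih =>
    ext1 v
    ext1
    have := LinearMap.congr_fun ih (bdry (m + 1) (Finsupp.single v 1))
    simp only [LinearMap.add_apply, LinearMap.comp_apply, bdry_bdry, map_zero, add_zero,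
      LinearMap.sub_apply, LinearMap.id_apply] at this
    simp only [LinearMap.add_apply, LinearMap.comp_apply, Finsupp.lsingle_apply, sdHtpy_single,
      bdry_cone, LinearMap.sub_apply, LinearMap.id_apply, sd_single (m := m + 1), map_sub, this]
    abel

variable {β β'}

lemma map_sd {φ : P → Q} (hφ : ∀ m v, φ (β m v) = β' m (φ ∘ v)) {m : ℕ} (c : TupleChain P m) :
    map φ m (sd β m c) = sd β' m (map φ m c) := by
  suffices h : ∀ m, map φ m ∘ₗ sd β m = sd β' m ∘ₗ map φ m from LinearMap.congr_fun (h m) c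
  intro m
  induction m with
  | zero => rfl
  | succ m ih =>
    ext1 v
    ext1
    have := LinearMap.congr_fun ih (bdry m (Finsupp.single v 1))
    simp only [LinearMap.comp_apply] at this
    simp only [LinearMap.comp_apply, Finsupp.lsingle_apply, sd_single, map_single, map_cone, hφ,
      this, map_bdry]

lemma map_sdHtpy {φ : P → Q} (hφ : ∀ m v, φ (β m v) = β' m (φ ∘ v)) {m : ℕ}
    (c : TupleChain P m) :
    map φ (m + 1) (sdHtpy β m c) = sdHtpy β' m (map φ m c) := by
  suffices h : ∀ m, map φ (m + 1) ∘ₗ sdHtpy β m = sdHtpy β' m ∘ₗ map φ m from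
    LinearMap.congr_fun (h m) c
  intro m
  induction m with
  | zero => simp [sdHtpy]
  | succ m ih =>
    ext1 v
    ext1
    have := LinearMap.congr_fun ih (bdry m (Finsupp.single v 1))
    simp only [LinearMap.comp_apply] at this
    simp only [LinearMap.comp_apply, Finsupp.lsingle_apply, sdHtpy_single, map_single, map_cone,
      hφ, this, map_bdry, map_sub]

end TupleChain

lemma Finsupp.apply_mem_of_mem_supported {α M : Type*} [AddCommGroup M] [Module ℝ M]
    (f : (α →₀ ℝ) →ₗ[ℝ] M) {s : Set α} {S : Submodule ℝ M}
    (h : ∀ a ∈ s, f (Finsupp.single a 1) ∈ S) {c : α →₀ ℝ}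
    (hc : c ∈ Finsupp.supported ℝ ℝ s) : f c ∈ S := by
  rw [Finsupp.supported_eq_span_single] at hc
  suffices Submodule.span ℝ ((fun i ↦ Finsupp.single i (1 : ℝ)) '' s) ≤ S.comap f from this hc
  rw [Submodule.span_le]
  rintro _ ⟨a, ha, rfl⟩
  exact h a ha

/-- The affine map between standard simplices sending the `j`-th vertex to `v j`. -/
noncomputable def affineSimplex {k n : ℕ} (v : Fin k → stdSimplex ℝ (Fin n)) :
    C(stdSimplex ℝ (Fin k), stdSimplex ℝ (Fin n)) where
  toFun t := ⟨∑ j, t j • (v j : Fin n → ℝ),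
    (convex_stdSimplex ℝ (Fin n)).sum_mem (fun j _ ↦ t.2.1 j) t.2.2 fun j _ ↦ (v j).2⟩
  continuous_toFun := by
    refine Continuous.subtype_mk (continuous_finsetSum _ fun j _ ↦ ?_) _
    exact ((continuous_apply j).comp continuous_subtype_val).smul continuous_const

lemma affineSimplex_coe {k n : ℕ} (v : Fin k → stdSimplex ℝ (Fin n)) (t : stdSimplex ℝ (Fin k)) :
    (affineSimplex v t : Fin n → ℝ) = ∑ j, t j • (v j : Fin n → ℝ) := rfl

lemma affineSimplex_comp {k m n : ℕ} (v : Fin m → stdSimplex ℝ (Fin n))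
    (w : Fin k → stdSimplex ℝ (Fin m)) :
    (affineSimplex v).comp (affineSimplex w) = affineSimplex (affineSimplex v ∘ w) := by
  ext t : 1
  apply stdSimplex.ext
  simp only [ContinuousMap.comp_apply, affineSimplex_coe, Function.comp_apply, Finset.smul_sum,
    smul_smul]
  rw [Finset.sum_comm]
  refine Finset.sum_congr rfl fun j _ ↦ ?_
  rw [← Finset.sum_smul]
  congr 1
  rw [Finset.sum_apply]
  rfl

lemma affineSimplex_vertex {k n : ℕ} (v : Fin k → stdSimplex ℝ (Fin n)) (j : Fin k) :
    affineSimplex v (stdSimplex.vertex j) = v j := by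
  apply stdSimplex.ext
  simp [affineSimplex_coe, Pi.single_apply]

lemma affineSimplex_comp_vertex {k n : ℕ} (v : Fin k → stdSimplex ℝ (Fin n)) :
    affineSimplex v ∘ stdSimplex.vertex = v :=
  funext (affineSimplex_vertex v)

lemma affineSimplex_vertex_id (n : ℕ) :
    affineSimplex (stdSimplex.vertex : Fin n → stdSimplex ℝ (Fin n)) = ContinuousMap.id _ := by
  ext t : 1
  apply stdSimplex.ext
  funext i
  simp [affineSimplex_coe, Finset.sum_apply, Pi.single_apply]

lemma affineSimplex_vertex_comp {k n : ℕ} (f : Fin k → Fin n) (t : stdSimplex ℝ (Fin k)) :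
    affineSimplex (stdSimplex.vertex ∘ f) t = stdSimplex.map f t := by
  apply stdSimplex.ext
  funext i
  simp [affineSimplex_coe, Finset.sum_apply, Pi.single_apply,
    FunOnFinite.linearMap_apply_apply, Finset.sum_filter, eq_comm]

lemma dist_affineSimplex_le {k n : ℕ} {v : Fin k → stdSimplex ℝ (Fin n)}
    {x : stdSimplex ℝ (Fin n)} {R : ℝ} (h : ∀ j, dist (v j) x ≤ R) (t : stdSimplex ℝ (Fin k)) :
    dist (affineSimplex v t) x ≤ R := by
  have : (affineSimplex v t : Fin n → ℝ) ∈ Metric.closedBall (x : Fin n → ℝ) R :=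
    (convex_closedBall _ _).sum_mem (fun j _ ↦ t.2.1 j) t.2.2 fun j _ ↦ h j
  exact this

/-- The barycenter of a nonempty tuple of points of a standard simplex. -/
noncomputable def tupleBarycenter (n m : ℕ) (v : Fin (m + 1) → stdSimplex ℝ (Fin n)) :
    stdSimplex ℝ (Fin n) :=
  affineSimplex v stdSimplex.barycenter

lemma affineSimplex_tupleBarycenter {k n : ℕ} (v : Fin k → stdSimplex ℝ (Fin n)) (m : ℕ)
    (w : Fin (m + 1) → stdSimplex ℝ (Fin k)) :
    affineSimplex v (tupleBarycenter k m w) = tupleBarycenter n m (affineSimplex v ∘ w) :=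
  DFunLike.congr_fun (affineSimplex_comp v w) _

lemma dist_tupleBarycenter_le {n m : ℕ} {v : Fin (m + 1) → stdSimplex ℝ (Fin n)} {D : ℝ}
    (h : ∀ i j, dist (v i) (v j) ≤ D) (i : Fin (m + 1)) :
    dist (v i) (tupleBarycenter n m v) ≤ m / (m + 1) * D := by
  rw [dist_comm]
  change dist ⇑(tupleBarycenter n m v) ⇑(v i) ≤ _
  rw [dist_eq_norm]
  have hb : (tupleBarycenter n m v : Fin n → ℝ) - v i
      = ∑ j, (1 / (m + 1 : ℝ)) • ((v j : Fin n → ℝ) - v i) := by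
    rw [← Finset.smul_sum, Finset.sum_sub_distrib, smul_sub, tupleBarycenter, affineSimplex_coe,
      Finset.smul_sum]
    congr 1
    · refine Finset.sum_congr rfl fun j _ ↦ ?_
      congr 1
      exact (stdSimplex.barycenter_apply j).trans (by simp)
    · rw [Finset.sum_const, Finset.card_univ, Fintype.card_fin, ← Nat.cast_smul_eq_nsmul ℝ,
        smul_smul]
      push_cast
      rw [one_div_mul_cancel (by positivity), one_smul]
  rw [hb, Fin.sum_univ_succAbove _ i, sub_self, smul_zero, zero_add]
  refine (norm_sum_le _ _).trans ?_
  have : ∀ j ∈ Finset.univ, ‖(1 / (m + 1 : ℝ)) • ((v (i.succAbove j) : Fin n → ℝ) - v i)‖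
      ≤ 1 / (m + 1) * D := by
    intro j _
    rw [norm_smul, Real.norm_of_nonneg (by positivity), ← dist_eq_norm]
    gcongr
    exact h _ _
  refine (Finset.sum_le_sum this).trans (le_of_eq ?_)
  simp
  ring

namespace TupleChain

lemma sd_mem_supported_dist {n m : ℕ} (x : stdSimplex ℝ (Fin n)) (R : ℝ)
    {c : TupleChain (stdSimplex ℝ (Fin n)) m}
    (hc : c ∈ Finsupp.supported ℝ ℝ {v | ∀ i, dist (v i) x ≤ R}) :
    sd (tupleBarycenter n) m c ∈ Finsupp.supported ℝ ℝ {v | ∀ i, dist (v i) x ≤ R} := by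
  induction m with
  | zero => exact hc
  | succ m ih =>
    refine Finsupp.apply_mem_of_mem_supported _ (fun v hv ↦ ?_) hc
    rw [sd_single]
    refine Finsupp.apply_mem_of_mem_supported _ (fun w hw ↦ ?_) (ih ?_)
    · rw [cone_single]
      refine Finsupp.single_mem_supported _ _ fun i ↦ ?_
      refine Fin.cases ?_ (fun j ↦ ?_) i
      · exact dist_affineSimplex_le hv _
      · exact hw j
    · rw [bdry_single]
      exact Submodule.sum_mem _ fun i _ ↦ Submodule.smul_mem _ _
        (Finsupp.single_mem_supported _ _ fun j ↦ hv _)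

lemma sd_mem_supported_mesh {n m : ℕ} {D : ℝ} (hD : 0 ≤ D)
    {c : TupleChain (stdSimplex ℝ (Fin n)) m}
    (hc : c ∈ Finsupp.supported ℝ ℝ {v | ∀ i j, dist (v i) (v j) ≤ D}) :
    sd (tupleBarycenter n) m c ∈
      Finsupp.supported ℝ ℝ {v | ∀ i j, dist (v i) (v j) ≤ (m - 1 : ℕ) / m * D} := by
  induction m with
  | zero => exact Finsupp.mem_supported _ _ |>.2 fun v _ i ↦ i.elim0
  | succ m ih =>
    refine Finsupp.apply_mem_of_mem_supported _ (fun v hv ↦ ?_) hc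
    rw [sd_single]
    have hb : bdry m (Finsupp.single v 1) ∈ Finsupp.supported ℝ ℝ
        {w : Fin m → stdSimplex ℝ (Fin n) | ∀ i j, dist (w i) (w j) ≤ D} := by
      rw [bdry_single]
      exact Submodule.sum_mem _ fun i _ ↦ Submodule.smul_mem _ _
        (Finsupp.single_mem_supported _ _ fun j k ↦ hv _ _)
    have hb' : bdry m (Finsupp.single v 1) ∈ Finsupp.supported ℝ ℝ
        {w : Fin m → stdSimplex ℝ (Fin n) |
          ∀ i, dist (w i) (tupleBarycenter n m v) ≤ m / (m + 1) * D} := by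
      rw [bdry_single]
      exact Submodule.sum_mem _ fun i _ ↦ Submodule.smul_mem _ _
        (Finsupp.single_mem_supported _ _ fun j ↦ dist_tupleBarycenter_le hv _)
    have h12 := Submodule.mem_inf.2 ⟨ih hb, sd_mem_supported_dist _ _ hb'⟩
    rw [← Finsupp.supported_inter] at h12
    refine Finsupp.apply_mem_of_mem_supported _ (fun w hw ↦ ?_) h12
    rw [cone_single]
    refine Finsupp.single_mem_supported _ _ fun i j ↦ ?_
    have hle : ((m - 1 : ℕ) : ℝ) / m * D ≤ m / (m + 1) * D := by
      refine mul_le_mul_of_nonneg_right ?_ hD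
      rcases m with _ | m
      · simp
      · push_cast [Nat.add_sub_cancel]
        rw [div_le_div_iff₀ (by positivity) (by positivity)]
        nlinarith
    push_cast [Nat.add_sub_cancel]
    refine Fin.cases ?_ (fun i ↦ ?_) i <;> refine Fin.cases ?_ (fun j ↦ ?_) j
    · simp only [dist_self]
      positivity
    · rw [dist_comm]
      exact hw.2 j
    · exact hw.2 i
    · exact (hw.1 i j).trans hle

lemma exists_iterate_sd_mem_supported {n m : ℕ} {ε : ℝ} (hε : 0 < ε)
    (c : TupleChain (stdSimplex ℝ (Fin n)) m) :
    ∃ N, (sd (tupleBarycenter n) m)^[N] c ∈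
      Finsupp.supported ℝ ℝ {v | ∀ i j, dist (v i) (v j) < ε} := by
  have hN : ∀ N : ℕ, (sd (tupleBarycenter n) m)^[N] c ∈ Finsupp.supported ℝ ℝ
      {v | ∀ i j, dist (v i) (v j) ≤ (((m - 1 : ℕ) : ℝ) / m) ^ N *
        Metric.diam (Set.univ : Set (stdSimplex ℝ (Fin n)))} := by
    intro N
    induction N with
    | zero =>
      refine (Finsupp.mem_supported _ _).2 fun v _ i j ↦ ?_
      rw [pow_zero, one_mul]
      exact Metric.dist_le_diam_of_mem isCompact_univ.isBounded trivial trivial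
    | succ N ih =>
      rw [Function.iterate_succ_apply', pow_succ', mul_assoc]
      exact sd_mem_supported_mesh (mul_nonneg (by positivity) Metric.diam_nonneg) ih
  have hlt : ((m - 1 : ℕ) : ℝ) / m < 1 := by
    rcases m with _ | m
    · simp
    · rw [div_lt_one (by positivity)]
      push_cast [Nat.add_sub_cancel]
      linarith
  have hlim := (tendsto_pow_atTop_nhds_zero_of_lt_one (by positivity) hlt).mul_const
    (Metric.diam (Set.univ : Set (stdSimplex ℝ (Fin n))))
  rw [zero_mul] at hlim
  obtain ⟨N, hN'⟩ := (hlim.eventually_lt_const hε).exists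
  exact ⟨N, Finsupp.supported_mono (fun v hv i j ↦ (hv i j).trans_lt hN') (hN N)⟩

end TupleChain

/-- The free real vector space on the singular `k`-simplices of `X`. -/
abbrev SingChain (X : Type) [TopologicalSpace X] (k : ℕ) : Type :=
  C(stdSimplex ℝ (Fin (k + 1)), X) →₀ ℝ

namespace SingChain

variable {X : Type} [TopologicalSpace X]

/-- The inclusion of the `i`-th face of a standard simplex. -/
noncomputable def face {k : ℕ} (i : Fin (k + 2)) :
    C(stdSimplex ℝ (Fin (k + 1)), stdSimplex ℝ (Fin (k + 2))) :=
  ⟨stdSimplex.map i.succAbove, stdSimplex.continuous_map _⟩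

lemma face_eq {k : ℕ} (i : Fin (k + 2)) :
    face i = affineSimplex (stdSimplex.vertex ∘ i.succAbove) :=
  ContinuousMap.ext fun t ↦ (affineSimplex_vertex_comp _ t).symm

/-- The boundary of singular chains. -/
noncomputable def bdry (k : ℕ) : SingChain X (k + 1) →ₗ[ℝ] SingChain X k :=
  ∑ i : Fin (k + 2), (-1 : ℝ) ^ (i : ℕ) • Finsupp.lmapDomain ℝ ℝ (fun σ ↦ σ.comp (face i))

lemma bdry_single {k : ℕ} (σ : C(stdSimplex ℝ (Fin (k + 2)), X)) :
    bdry k (Finsupp.single σ 1) =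
      ∑ i : Fin (k + 2), (-1 : ℝ) ^ (i : ℕ) • Finsupp.single (σ.comp (face i)) 1 := by
  simp [bdry, LinearMap.sum_apply]

/-- The singular chain obtained from a tuple chain in a standard simplex and a singular simplex. -/
noncomputable def ofTuple {n k : ℕ} (σ : C(stdSimplex ℝ (Fin n), X)) :
    TupleChain (stdSimplex ℝ (Fin n)) (k + 1) →ₗ[ℝ] SingChain X k :=
  Finsupp.lmapDomain ℝ ℝ (fun v ↦ σ.comp (affineSimplex v))

@[simp] lemma ofTuple_single {n k : ℕ} (σ : C(stdSimplex ℝ (Fin n), X))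
    (v : Fin (k + 1) → stdSimplex ℝ (Fin n)) :
    ofTuple σ (Finsupp.single v 1) = Finsupp.single (σ.comp (affineSimplex v)) 1 := by
  simp [ofTuple]

lemma bdry_ofTuple {n k : ℕ} (σ : C(stdSimplex ℝ (Fin n), X))
    (c : TupleChain (stdSimplex ℝ (Fin n)) (k + 2)) :
    bdry k (ofTuple σ c) = ofTuple σ (TupleChain.bdry (k + 1) c) := by
  suffices h : bdry k ∘ₗ ofTuple σ = ofTuple σ ∘ₗ TupleChain.bdry (k + 1) from
    LinearMap.congr_fun h c
  ext1 v
  ext1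
  simp only [LinearMap.comp_apply, Finsupp.lsingle_apply, ofTuple_single, bdry_single,
    TupleChain.bdry_single, map_sum, map_smul, ContinuousMap.comp_assoc, face_eq,
    affineSimplex_comp, ← Function.comp_assoc, affineSimplex_comp_vertex]

lemma ofTuple_comp_affineSimplex {m n k : ℕ} (σ : C(stdSimplex ℝ (Fin n), X))
    (v : Fin m → stdSimplex ℝ (Fin n)) (c : TupleChain (stdSimplex ℝ (Fin m)) (k + 1)) :
    ofTuple (σ.comp (affineSimplex v)) c = ofTuple σ (TupleChain.map (affineSimplex v) _ c) := by
  suffices h : ofTuple (k := k) (σ.comp (affineSimplex v))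
      = ofTuple σ ∘ₗ TupleChain.map (affineSimplex v) _ from LinearMap.congr_fun h c
  ext1 w
  ext1
  simp only [LinearMap.comp_apply, Finsupp.lsingle_apply, ofTuple_single, TupleChain.map_single,
    ContinuousMap.comp_assoc, affineSimplex_comp]

/-- The tuple of vertices of the standard simplex, as a tuple chain. -/
noncomputable def vertices (k : ℕ) : TupleChain (stdSimplex ℝ (Fin k)) k :=
  Finsupp.single stdSimplex.vertex 1

lemma map_vertices {n k : ℕ} (v : Fin k → stdSimplex ℝ (Fin n)) :
    TupleChain.map (affineSimplex v) k (vertices k) = Finsupp.single v 1 := by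
  simp only [vertices, TupleChain.map_single, affineSimplex_comp_vertex]

lemma ofTuple_vertices {k : ℕ} (σ : C(stdSimplex ℝ (Fin (k + 1)), X)) :
    ofTuple σ (vertices (k + 1)) = Finsupp.single σ 1 := by
  rw [vertices, ofTuple_single, affineSimplex_vertex_id, ContinuousMap.comp_id]

/-- Barycentric subdivision of singular chains. -/
noncomputable def sd (k : ℕ) : SingChain X k →ₗ[ℝ] SingChain X k :=
  Finsupp.linearCombination ℝ fun σ ↦
    ofTuple σ (TupleChain.sd (tupleBarycenter (k + 1)) (k + 1) (vertices (k + 1)))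

/-- The chain homotopy between the identity and barycentric subdivision. -/
noncomputable def sdHtpy (k : ℕ) : SingChain X k →ₗ[ℝ] SingChain X (k + 1) :=
  Finsupp.linearCombination ℝ fun σ ↦
    ofTuple σ (TupleChain.sdHtpy (tupleBarycenter (k + 1)) (k + 1) (vertices (k + 1)))

lemma sd_single {k : ℕ} (σ : C(stdSimplex ℝ (Fin (k + 1)), X)) :
    sd k (Finsupp.single σ 1) =
      ofTuple σ (TupleChain.sd (tupleBarycenter (k + 1)) (k + 1) (vertices (k + 1))) := by
  simp [sd]

lemma sdHtpy_single {k : ℕ} (σ : C(stdSimplex ℝ (Fin (k + 1)), X)) :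
    sdHtpy k (Finsupp.single σ 1) =
      ofTuple σ (TupleChain.sdHtpy (tupleBarycenter (k + 1)) (k + 1) (vertices (k + 1))) := by
  simp [sdHtpy]

lemma sd_ofTuple {n k : ℕ} (σ : C(stdSimplex ℝ (Fin n), X))
    (c : TupleChain (stdSimplex ℝ (Fin n)) (k + 1)) :
    sd k (ofTuple σ c) = ofTuple σ (TupleChain.sd (tupleBarycenter n) (k + 1) c) := by
  suffices h : sd k ∘ₗ ofTuple σ = ofTuple σ ∘ₗ TupleChain.sd (tupleBarycenter n) (k + 1) from
    LinearMap.congr_fun h c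
  ext1 v
  ext1
  simp only [LinearMap.comp_apply, Finsupp.lsingle_apply, ofTuple_single, sd_single,
    ofTuple_comp_affineSimplex, TupleChain.map_sd (affineSimplex_tupleBarycenter v), map_vertices]

lemma sdHtpy_ofTuple {n k : ℕ} (σ : C(stdSimplex ℝ (Fin n), X))
    (c : TupleChain (stdSimplex ℝ (Fin n)) (k + 1)) :
    sdHtpy k (ofTuple σ c) = ofTuple σ (TupleChain.sdHtpy (tupleBarycenter n) (k + 1) c) := by
  suffices h : sdHtpy k ∘ₗ ofTuple σ
      = ofTuple σ ∘ₗ TupleChain.sdHtpy (tupleBarycenter n) (k + 1) from LinearMap.congr_fun h c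
  ext1 v
  ext1
  simp only [LinearMap.comp_apply, Finsupp.lsingle_apply, ofTuple_single, sdHtpy_single,
    ofTuple_comp_affineSimplex, TupleChain.map_sdHtpy (affineSimplex_tupleBarycenter v),
    map_vertices]

lemma bdry_sd {k : ℕ} (c : SingChain X (k + 1)) : bdry k (sd (k + 1) c) = sd k (bdry k c) := by
  suffices h : bdry (X := X) k ∘ₗ sd (k + 1) = sd k ∘ₗ bdry k from LinearMap.congr_fun h c
  ext1 σ
  ext1
  simp only [LinearMap.comp_apply, Finsupp.lsingle_apply]
  rw [← ofTuple_vertices, sd_ofTuple, bdry_ofTuple, bdry_ofTuple, sd_ofTuple, TupleChain.bdry_sd]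

lemma bdry_sdHtpy {k : ℕ} (c : SingChain X (k + 1)) :
    bdry (k + 1) (sdHtpy (k + 1) c) + sdHtpy k (bdry k c) = c - sd (k + 1) c := by
  suffices h : bdry (X := X) (k + 1) ∘ₗ sdHtpy (k + 1) + sdHtpy k ∘ₗ bdry k
    = LinearMap.id - sd (k + 1) from LinearMap.congr_fun h c
  ext1 σ
  ext1
  simp only [LinearMap.comp_apply, LinearMap.add_apply, LinearMap.sub_apply, LinearMap.id_apply,
    Finsupp.lsingle_apply]
  rw [← ofTuple_vertices, sd_ofTuple, sdHtpy_ofTuple, bdry_ofTuple, bdry_ofTuple, sdHtpy_ofTuple,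
    ← map_add, ← map_sub, TupleChain.bdry_sdHtpy]

/-- The singular chains supported on simplices contained in `U` or in `V`. -/
noncomputable def small (U V : Set X) (k : ℕ) : Submodule ℝ (SingChain X k) :=
  Finsupp.supported ℝ ℝ {σ | Set.range σ ⊆ U ∨ Set.range σ ⊆ V}

lemma ofTuple_mem_small {U V : Set X} {n k : ℕ} {σ : C(stdSimplex ℝ (Fin n), X)}
    (hσ : Set.range σ ⊆ U ∨ Set.range σ ⊆ V) (c : TupleChain (stdSimplex ℝ (Fin n)) (k + 1)) :
    ofTuple σ c ∈ small U V k := by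
  refine Finsupp.apply_mem_of_mem_supported (s := Set.univ) _ (fun v _ ↦ ?_)
    (by rw [Finsupp.supported_univ]; trivial)
  rw [ofTuple_single]
  have : Set.range (σ.comp (affineSimplex v)) ⊆ Set.range σ := by
    rw [ContinuousMap.coe_comp]
    exact Set.range_comp_subset_range _ _
  exact Finsupp.single_mem_supported _ _ (hσ.imp this.trans this.trans)

lemma sd_mem_small {U V : Set X} {k : ℕ} {c : SingChain X k} (hc : c ∈ small U V k) :
    sd k c ∈ small U V k :=
  Finsupp.apply_mem_of_mem_supported _
    (fun σ hσ ↦ by rw [sd_single]; exact ofTuple_mem_small hσ _) hc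

lemma sdHtpy_mem_small {U V : Set X} {k : ℕ} {c : SingChain X k} (hc : c ∈ small U V k) :
    sdHtpy k c ∈ small U V (k + 1) :=
  Finsupp.apply_mem_of_mem_supported _
    (fun σ hσ ↦ by rw [sdHtpy_single]; exact ofTuple_mem_small hσ _) hc

lemma iterate_sd_mem_small {U V : Set X} {k N M : ℕ} (h : N ≤ M) {c : SingChain X k}
    (hc : (sd k)^[N] c ∈ small U V k) : (sd k)^[M] c ∈ small U V k := by
  induction M, h using Nat.le_induction with
  | base => exact hc
  | succ M _ ih =>
    rw [Function.iterate_succ_apply']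
    exact sd_mem_small ih

lemma exists_iterate_sd_mem_small {U V : Set X} (hU : IsOpen U) (hV : IsOpen V)
    (hUV : U ∪ V = Set.univ) {k : ℕ} (c : SingChain X k) :
    ∃ N, (sd k)^[N] c ∈ small U V k := by
  induction c using Finsupp.induction_linear with
  | zero => exact ⟨0, Submodule.zero_mem _⟩
  | add f g hf hg =>
    obtain ⟨N, hN⟩ := hf
    obtain ⟨M, hM⟩ := hg
    refine ⟨max N M, ?_⟩
    rw [← Module.End.coe_pow, map_add, Module.End.coe_pow]
    exact Submodule.add_mem _ (iterate_sd_mem_small (le_max_left _ _) hN)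
      (iterate_sd_mem_small (le_max_right _ _) hM)
  | single σ r =>
    obtain ⟨ε, hε, hball⟩ := lebesgue_number_lemma_of_metric (s := Set.univ)
      (c := fun b : Bool ↦ cond b (σ ⁻¹' U) (σ ⁻¹' V)) isCompact_univ
      (fun b ↦ by cases b <;> [exact hV.preimage σ.continuous; exact hU.preimage σ.continuous])
      (fun x _ ↦ by
        have : σ x ∈ U ∪ V := hUV ▸ Set.mem_univ _
        rcases this with h | h
        · exact Set.mem_iUnion.2 ⟨true, h⟩
        · exact Set.mem_iUnion.2 ⟨false, h⟩)
    obtain ⟨N, hN⟩ := TupleChain.exists_iterate_sd_mem_supported hε (vertices (k + 1))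
    refine ⟨N, ?_⟩
    have hsd : ∀ N, (sd k)^[N] (ofTuple σ (vertices (k + 1)))
        = ofTuple σ ((TupleChain.sd (tupleBarycenter _) (k + 1))^[N] (vertices (k + 1))) := by
      intro N
      induction N with
      | zero => rfl
      | succ N ih => rw [Function.iterate_succ_apply', Function.iterate_succ_apply', ih, sd_ofTuple]
    have hr : Finsupp.single σ r = r • ofTuple σ (vertices (k + 1)) := by
      rw [ofTuple_vertices, Finsupp.smul_single, smul_eq_mul, mul_one]
    rw [hr, ← Module.End.coe_pow, map_smul, Module.End.coe_pow, hsd]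
    refine Submodule.smul_mem _ _ (Finsupp.apply_mem_of_mem_supported _ (fun v hv ↦ ?_) hN)
    rw [ofTuple_single]
    refine Finsupp.single_mem_supported _ _ ?_
    obtain ⟨b, hb⟩ := hball (v 0) trivial
    have hmem : ∀ t, affineSimplex v t ∈ Metric.ball (v 0) ε := by
      intro t
      obtain ⟨j, hj⟩ := Finite.exists_max fun j ↦ dist (v j) (v 0)
      exact (dist_affineSimplex_le hj t).trans_lt (hv j 0)
    cases b
    · right
      rintro _ ⟨t, rfl⟩
      exact hb (hmem t)
    · left
      rintro _ ⟨t, rfl⟩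
      exact hb (hmem t)

/-- Modulo boundaries, every chain with small boundary is small. -/
lemma exists_sub_bdry_mem_small {U V : Set X} (hU : IsOpen U) (hV : IsOpen V)
    (hUV : U ∪ V = Set.univ) {k : ℕ} (c : SingChain X (k + 1)) (hc : bdry k c ∈ small U V k) :
    ∃ e, c - bdry (k + 1) e ∈ small U V (k + 1) := by
  obtain ⟨N, hN⟩ := exists_iterate_sd_mem_small hU hV hUV c
  induction N generalizing c with
  | zero => exact ⟨0, by simpa using hN⟩
  | succ N ih =>
    obtain ⟨e, he⟩ := ih (sd (k + 1) c) (by rw [bdry_sd]; exact sd_mem_small hc) hN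
    refine ⟨e + sdHtpy (k + 1) c, ?_⟩
    have : c - bdry (k + 1) (e + sdHtpy (k + 1) c)
        = (sd (k + 1) c - bdry (k + 1) e) + sdHtpy k (bdry k c) := by
      rw [map_add, eq_sub_of_add_eq' (bdry_sdHtpy c)]
      abel
    rw [this]
    exact Submodule.add_mem _ he (sdHtpy_mem_small hc)

lemma small_zero {U V : Set X} (hUV : U ∪ V = Set.univ) (c : SingChain X 0) :
    c ∈ small U V 0 := by
  refine (Finsupp.mem_supported _ _).2 fun σ _ ↦ ?_
  have h : ∀ t, σ t = σ default := fun t ↦ congrArg σ (Subsingleton.elim _ _)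
  have : σ default ∈ U ∪ V := hUV ▸ Set.mem_univ _
  refine this.imp ?_ ?_ <;>
  · rintro hm _ ⟨t, rfl⟩
    rwa [h]

end SingChain

open Limits HomologicalComplex in
/-- The rank of the kernel of a chain map on homology in degree `k - 1`
(zero when `k = 0`). -/
noncomputable def prevKerRank {K L : ChainComplex (ModuleCat ℝ) ℕ} (f : K ⟶ L) : ℕ → Cardinal
  | 0 => 0
  | k + 1 => Module.rank ℝ (LinearMap.ker (HomologicalComplex.homologyMap f k).hom)

open Limits HomologicalComplex in
lemma rank_homology_of_shortExact {S : ShortComplex (ChainComplex (ModuleCat ℝ) ℕ)}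
    (hS : S.ShortExact) (k : ℕ) :
    Module.rank ℝ (S.X₃.homology k) + Module.rank ℝ (S.X₁.homology k) =
      Module.rank ℝ (S.X₂.homology k)
        + Module.rank ℝ (LinearMap.ker (homologyMap S.f k).hom) + prevKerRank S.f k := by
  have e₂ := (hS.homology_exact₂ k).moduleCat_range_eq_ker
  dsimp only at e₂
  have r₁ := LinearMap.rank_range_add_rank_ker (homologyMap S.f k).hom
  have r₂ := LinearMap.rank_range_add_rank_ker (homologyMap S.g k).hom
  rw [← e₂] at r₂
  have r₃ : Module.rank ℝ (S.X₃.homology k) =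
      Module.rank ℝ (LinearMap.range (homologyMap S.g k).hom) + prevKerRank S.f k := by
    cases k with
    | zero =>
      have := hS.epi_g
      have : Epi (homologyMap S.g 0) := epi_homologyMap_of_epi_of_not_rel _ _ (by simp)
      rw [LinearMap.range_eq_top.mpr ((ModuleCat.epi_iff_surjective _).mp this)]
      simp [prevKerRank]
    | succ k =>
      have e₃ := (hS.homology_exact₃ (k + 1) k rfl).moduleCat_range_eq_ker
      have e₁ := (hS.homology_exact₁ (k + 1) k rfl).moduleCat_range_eq_ker
      dsimp only at e₁ e₃
      have r := LinearMap.rank_range_add_rank_ker (hS.δ (k + 1) k rfl).hom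
      rw [← e₃, e₁] at r
      rw [prevKerRank, ← r, add_comm]
  rw [r₃, ← r₁, ← r₂]
  ring

open Limits HomologicalComplex in
/-- Rank count in the long exact homology sequence of `K ⟶ L ⟶ M`, where `L ⟶ M` need only be
surjective up to an acyclic cokernel. -/
lemma rank_homology_of_almost_shortExact {K L M : ChainComplex (ModuleCat ℝ) ℕ}
    (f : K ⟶ L) (g : L ⟶ M) (w : f ≫ g = 0)
    (hf : ∀ k, Function.Injective (f.f k))
    (hfg : ∀ k (x : L.X k), g.f k x = 0 → ∃ y, f.f k y = x)
    (hg₀ : Function.Surjective (g.f 0))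
    (hg : ∀ k (c : M.X (k + 1)), M.d (k + 1) k c ∈ LinearMap.range (g.f k).hom →
      ∃ e : M.X (k + 2), c - M.d (k + 2) (k + 1) e ∈ LinearMap.range (g.f (k + 1)).hom)
    (k : ℕ) :
    Module.rank ℝ (M.homology k) + Module.rank ℝ (K.homology k) =
      Module.rank ℝ (L.homology k)
        + Module.rank ℝ (LinearMap.ker (homologyMap f k).hom) + prevKerRank f k := by
  let π := cokernel.π g
  have hπ (k : ℕ) : Function.Surjective (π.f k) :=
    (ModuleCat.epi_iff_surjective _).mp inferInstance
  have hgπ (k : ℕ) (x) (hx : π.f k x = 0) : ∃ y, g.f k y = x := by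
    have h : (ShortComplex.mk g π (cokernel.condition g)).Exact := ShortComplex.exact_cokernel g
    have := (exact_iff_degreewise_exact _).mp h k
    rw [ShortComplex.moduleCat_exact_iff] at this
    exact this x hx
  have hπg (k : ℕ) (y) : π.f k (g.f k y) = 0 := by
    exact congr($(cokernel.condition g).f k y)
  have hQ (k : ℕ) : (cokernel g).ExactAt k := by
    cases k with
    | zero =>
      refine ShortComplex.exact_of_isZero_X₂ _ ?_
      have : Subsingleton ((cokernel g).X 0) := by
        refine ⟨fun a b ↦ ?_⟩
        obtain ⟨a, rfl⟩ := hπ 0 a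
        obtain ⟨b, rfl⟩ := hπ 0 b
        obtain ⟨a, rfl⟩ := hg₀ a
        obtain ⟨b, rfl⟩ := hg₀ b
        rw [hπg, hπg]
      exact @ModuleCat.isZero_of_subsingleton ℝ _ _ this
    | succ k =>
      rw [exactAt_iff' _ (k + 2) (k + 1) k (by simp) (by simp), ShortComplex.moduleCat_exact_iff]
      intro q hq
      obtain ⟨c, rfl⟩ := hπ _ q
      have hc : π.f k (M.d (k + 1) k c) = 0 :=
        (congr($(π.comm (k + 1) k) c) : _).symm.trans hq
      obtain ⟨y, hy⟩ := hgπ _ _ hc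
      obtain ⟨e, z, hz⟩ := hg k c ⟨y, hy⟩
      refine ⟨π.f (k + 2) e, ?_⟩
      have h1 := hπg _ z
      erw [hz] at h1
      rw [map_sub, sub_eq_zero] at h1
      erw [h1]
      exact congr($(π.comm (k + 2) (k + 1)) e)
  let ι := kernel.ι π
  let p := kernel.lift π g (cokernel.condition g)
  have hp : p ≫ ι = g := kernel.lift_ι _ _ _
  have hιinj (k : ℕ) : Function.Injective (ι.f k) :=
    (ModuleCat.mono_iff_injective _).mp inferInstance
  have hp' (k : ℕ) (x) : ι.f k (p.f k x) = g.f k x := congr($(hp).f k x)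
  have hιπ (k : ℕ) (x) : π.f k (ι.f k x) = 0 := by
    exact congr($(kernel.condition π).f k x)
  have S₂ : (ShortComplex.mk ι π (kernel.condition π)).ShortExact :=
    { exact := ShortComplex.exact_kernel π
      mono_f := by dsimp; infer_instance
      epi_g := by dsimp; infer_instance }
  have w' : f ≫ p = 0 := by
    rw [← cancel_mono ι, Category.assoc, hp, w, zero_comp]
  have S₁ : (ShortComplex.mk f p w').ShortExact := by
    refine shortExact_of_degreewise_shortExact _ fun k ↦
      { exact := ?_, mono_f := ?_, epi_g := ?_ }
    · rw [ShortComplex.moduleCat_exact_iff]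
      intro x hx
      refine hfg k x ((hp' k x).symm.trans ?_)
      exact (congrArg (ι.f k) hx).trans (map_zero _)
    · exact (ModuleCat.mono_iff_injective _).mpr (hf k)
    · refine (ModuleCat.epi_iff_surjective _).mpr fun x ↦ ?_
      obtain ⟨y, hy⟩ := hgπ k _ (hιπ k x)
      exact ⟨y, hιinj k ((hp' k y).trans hy)⟩
  have hι : Module.rank ℝ ((kernel π).homology k) = Module.rank ℝ (M.homology k) := by
    have : Mono (homologyMap ι k) :=
      (S₂.homology_exact₁ (k + 1) k rfl).mono_g
        ((hQ (k + 1)).isZero_homology.eq_of_src _ _)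
    have : Epi (homologyMap ι k) :=
      (S₂.homology_exact₂ k).epi_f ((hQ k).isZero_homology.eq_of_tgt _ _)
    have : IsIso (homologyMap ι k) := isIso_of_mono_of_epi _
    exact (asIso (homologyMap ι k)).toLinearEquiv.rank_eq
  rw [← hι]
  exact rank_homology_of_shortExact S₁ k

lemma ModuleCat.sum_zsmul_apply {M N : ModuleCat ℝ} {m : ℕ} (a : Fin m → ℤ) (f : Fin m → (M ⟶ N))
    (x : M) : (∑ i, a i • f i : M ⟶ N) x = ∑ i, a i • f i x := by
  change (∑ i, a i • f i : M ⟶ N).hom x = _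
  rw [ModuleCat.hom_sum, LinearMap.sum_apply]
  rfl

section

variable {X Y Z : Type} [TopologicalSpace X] [TopologicalSpace Y] [TopologicalSpace Z]

/-- The singular chain complex as a functor. -/
noncomputable def singularChainFunctor : TopCat.{0} ⥤ ChainComplex (ModuleCat ℝ) ℕ :=
  TopCat.toSSet ⋙ (SimplicialObject.whiskering _ _).obj (ModuleCat.free ℝ) ⋙
    AlgebraicTopology.alternatingFaceMapComplex (ModuleCat ℝ)

/-- The map induced by a continuous map on singular chains. -/
noncomputable def singularChainMap (f : C(X, Y)) :
    singularChainComplex X ⟶ singularChainComplex Y :=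
  singularChainFunctor.map (TopCat.ofHom f)

lemma singularChainMap_id : singularChainMap (ContinuousMap.id X) = 𝟙 _ :=
  singularChainFunctor.map_id (TopCat.of X)

lemma singularChainMap_comp (g : C(Y, Z)) (f : C(X, Y)) :
    singularChainMap (g.comp f) = singularChainMap f ≫ singularChainMap g :=
  singularChainFunctor.map_comp (TopCat.ofHom f) (TopCat.ofHom g)

/-- The linear map induced by a continuous map on singular homology. -/
noncomputable def singularHomologyMap (f : C(X, Y)) (k : ℕ) :
    (singularChainComplex X).homology k →ₗ[ℝ] (singularChainComplex Y).homology k :=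
  (HomologicalComplex.homologyMap (singularChainMap f) k).hom

/-- The modules of the singular chain complex are the explicit modules of singular chains. -/
noncomputable def singularChainEquiv (X : Type) [TopologicalSpace X] (k : ℕ) :
    (singularChainComplex X).X k ≃ₗ[ℝ] SingChain X k :=
  Finsupp.domLCongr (TopCat.toSSetObjEquiv (TopCat.of X) (.op (SimplexCategory.mk k)))

/-- A singular simplex, as an element of the singular chain complex. -/
noncomputable def singularSimplex {k : ℕ}
    (σ : (TopCat.toSSet.obj (TopCat.of X)).obj (.op (SimplexCategory.mk k))) :
    (singularChainComplex X).X k :=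
  Finsupp.single σ (1 : ℝ)

lemma singularChainEquiv_singularSimplex {k : ℕ}
    (σ : (TopCat.toSSet.obj (TopCat.of X)).obj (.op (SimplexCategory.mk k))) :
    singularChainEquiv X k (singularSimplex σ) =
      Finsupp.single (TopCat.toSSetObjEquiv (TopCat.of X) _ σ) 1 :=
  Finsupp.domLCongr_single ..

lemma singularChainMap_singularSimplex (f : C(X, Y)) {k : ℕ}
    (σ : (TopCat.toSSet.obj (TopCat.of X)).obj (.op (SimplexCategory.mk k))) :
    (singularChainMap f).f k (singularSimplex σ) =
      singularSimplex ((TopCat.toSSet.map (TopCat.ofHom f)).app _ σ) :=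
  Finsupp.mapDomain_single

lemma singularChainEquiv_map (f : C(X, Y)) (k : ℕ) (c : (singularChainComplex X).X k) :
    singularChainEquiv Y k ((singularChainMap f).f k c) =
      Finsupp.mapDomain (fun σ ↦ f.comp σ) (singularChainEquiv X k c) := by
  suffices h : (singularChainEquiv Y k).toLinearMap ∘ₗ ((singularChainMap f).f k).hom =
      Finsupp.lmapDomain ℝ ℝ (fun σ ↦ f.comp σ) ∘ₗ (singularChainEquiv X k).toLinearMap from
    congr($h c)
  refine Finsupp.lhom_ext' fun σ ↦ LinearMap.ext_ring ?_
  change singularChainEquiv Y k ((singularChainMap f).f k (singularSimplex σ)) =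
    Finsupp.mapDomain (fun σ ↦ f.comp σ) (singularChainEquiv X k (singularSimplex σ))
  rw [singularChainMap_singularSimplex, singularChainEquiv_singularSimplex,
    singularChainEquiv_singularSimplex, Finsupp.mapDomain_single]
  rfl

lemma singularChainEquiv_d (k : ℕ) (c : (singularChainComplex X).X (k + 1)) :
    singularChainEquiv X k ((singularChainComplex X).d (k + 1) k c) =
      SingChain.bdry k (singularChainEquiv X (k + 1) c) := by
  suffices h : (singularChainEquiv X k).toLinearMap ∘ₗ ((singularChainComplex X).d (k + 1) k).hom =
      SingChain.bdry k ∘ₗ (singularChainEquiv X (k + 1)).toLinearMap from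
    congr($h c)
  refine Finsupp.lhom_ext' fun σ ↦ LinearMap.ext_ring ?_
  change singularChainEquiv X k ((singularChainComplex X).d (k + 1) k (singularSimplex σ)) =
    SingChain.bdry k (singularChainEquiv X (k + 1) (singularSimplex σ))
  have h : (singularChainComplex X).d (k + 1) k (singularSimplex σ) =
      ∑ i : Fin (k + 2), (-1 : ℤ) ^ (i : ℕ) •
        singularSimplex ((TopCat.toSSet.obj (TopCat.of X)).δ i σ) := by
    have h : (singularChainComplex X).d (k + 1) k = _ :=
      AlgebraicTopology.AlternatingFaceMapComplex.obj_d_eq _ k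
    refine congr($h (singularSimplex σ)).trans
      ((ModuleCat.sum_zsmul_apply _ _ _).trans (Finset.sum_congr rfl fun i _ ↦ ?_))
    congr 1
    exact Finsupp.mapDomain_single
  rw [h, singularChainEquiv_singularSimplex, map_sum, SingChain.bdry_single]
  refine Finset.sum_congr rfl fun i _ ↦ ?_
  rw [map_zsmul, singularChainEquiv_singularSimplex, ← Int.cast_smul_eq_zsmul ℝ]
  push_cast
  rfl
end

section

variable {W : Type} [TopologicalSpace W]

/-- The inclusion of subspaces as a continuous map. -/
def inclusionMap {A B : Set W} (h : A ⊆ B) : C(A, B) :=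
  ⟨Set.inclusion h, continuous_inclusion h⟩

lemma inclusionMap_comp_injective {A B : Set W} (h : A ⊆ B) (T : Type) [TopologicalSpace T] :
    Function.Injective (fun σ : C(T, A) ↦ (inclusionMap h).comp σ) := fun _ _ hστ ↦
  ContinuousMap.ext fun t ↦ Set.inclusion_injective h congr($hστ t)

lemma mem_range_inclusionMap_comp {A B : Set W} (h : A ⊆ B) {T : Type} [TopologicalSpace T]
    (σ : C(T, B)) (hσ : ∀ t, (σ t : W) ∈ A) :
    σ ∈ Set.range (fun σ : C(T, A) ↦ (inclusionMap h).comp σ) :=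
  ⟨⟨fun t ↦ ⟨σ t, hσ t⟩, by fun_prop⟩, rfl⟩

lemma singularChainMap_inclusionMap_injective {A B : Set W} (h : A ⊆ B) (k : ℕ) :
    Function.Injective ((singularChainMap (inclusionMap h)).f k) := by
  intro x y hxy
  apply (singularChainEquiv A k).injective
  apply Finsupp.mapDomain_injective (inclusionMap_comp_injective h _)
  rw [← singularChainEquiv_map, hxy, singularChainEquiv_map]

lemma mem_range_singularChainMap_inclusionMap {A B : Set W} (h : A ⊆ B) {k : ℕ}
    (c : (singularChainComplex B).X k)
    (hc : ∀ σ ∈ (singularChainEquiv B k c).support, ∀ t, (σ t : W) ∈ A) :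
    ∃ b, (singularChainMap (inclusionMap h)).f k b = c := by
  have h' : singularChainEquiv B k c ∈ Finsupp.supported ℝ ℝ
      ((fun σ : C(_, A) ↦ (inclusionMap h).comp σ) '' Set.univ) := by
    intro σ hσ
    rw [Set.image_univ]
    exact mem_range_inclusionMap_comp h σ (hc σ hσ)
  rw [← Finsupp.lmapDomain_supported] at h'
  obtain ⟨b, -, hb⟩ := h'
  refine ⟨(singularChainEquiv A k).symm b, (singularChainEquiv B k).injective ?_⟩
  rw [singularChainEquiv_map, LinearEquiv.apply_symm_apply]
  exact hb

lemma mem_support_singularChainMap_inclusionMap {A B : Set W} (h : A ⊆ B) {k : ℕ}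
    (b : (singularChainComplex A).X k) :
    ∀ σ ∈ (singularChainEquiv B k ((singularChainMap (inclusionMap h)).f k b)).support,
      ∀ t, (σ t : W) ∈ A := by
  intro σ hσ t
  classical
  rw [singularChainEquiv_map] at hσ
  obtain ⟨τ, -, rfl⟩ := Finset.mem_image.mp (Finsupp.mapDomain_support hσ)
  exact (τ t).2

open Limits

/-- The rank of the common kernel, on homology of `U ∩ V` in degree `k`, of the inclusions
into `U` and `V`. -/
noncomputable def interKerRank (U V : Set W) (k : ℕ) : Cardinal :=
  Module.rank ℝ
    ↥(LinearMap.ker (singularHomologyMap (inclusionMap (Set.inter_subset_left : U ∩ V ⊆ U)) k) ⊓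
      LinearMap.ker (singularHomologyMap (inclusionMap (Set.inter_subset_right : U ∩ V ⊆ V)) k))

lemma rank_homology_biprod (K L : ChainComplex (ModuleCat ℝ) ℕ) (k : ℕ) :
    Module.rank ℝ ((K ⊞ L).homology k) =
      Module.rank ℝ (K.homology k) + Module.rank ℝ (L.homology k) := by
  let F := HomologicalComplex.homologyFunctor (ModuleCat ℝ) (ComplexShape.down ℕ) k
  have := preservesBinaryBiproducts_of_preservesBiproducts F
  exact (F.mapBiprod K L ≪≫ ModuleCat.biprodIsoProd _ _).toLinearEquiv.rank_eq.trans
    (rank_prod' ..)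

lemma ker_homologyMap_biprod_lift {K L M : ChainComplex (ModuleCat ℝ) ℕ}
    (f : K ⟶ L) (g : K ⟶ M) (k : ℕ) :
    LinearMap.ker (HomologicalComplex.homologyMap (biprod.lift f (-g)) k).hom =
      LinearMap.ker (HomologicalComplex.homologyMap f k).hom ⊓
      LinearMap.ker (HomologicalComplex.homologyMap g k).hom := by
  ext z
  simp only [LinearMap.mem_ker, Submodule.mem_inf]
  have h₁ : HomologicalComplex.homologyMap (biprod.lift f (-g)) k ≫
      HomologicalComplex.homologyMap biprod.fst k = HomologicalComplex.homologyMap f k := by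
    rw [← HomologicalComplex.homologyMap_comp, biprod.lift_fst]
  have h₂ : HomologicalComplex.homologyMap (biprod.lift f (-g)) k ≫
      HomologicalComplex.homologyMap biprod.snd k = -HomologicalComplex.homologyMap g k := by
    rw [← HomologicalComplex.homologyMap_comp, biprod.lift_snd,
      HomologicalComplex.homologyMap_neg]
  have h₃ : HomologicalComplex.homologyMap (biprod.lift f (-g)) k =
      HomologicalComplex.homologyMap f k ≫ HomologicalComplex.homologyMap biprod.inl k -
      HomologicalComplex.homologyMap g k ≫ HomologicalComplex.homologyMap biprod.inr k := by
    rw [← HomologicalComplex.homologyMap_comp, ← HomologicalComplex.homologyMap_comp,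
      ← HomologicalComplex.homologyMap_sub]
    congr 1
    apply biprod.hom_ext <;> simp
  constructor
  · intro hz
    constructor
    · rw [← h₁, ModuleCat.hom_comp, LinearMap.comp_apply, hz, map_zero]
    · rw [← neg_eq_zero, ← LinearMap.neg_apply, ← ModuleCat.hom_neg, ← h₂, ModuleCat.hom_comp,
        LinearMap.comp_apply, hz, map_zero]
  · rintro ⟨hz₁, hz₂⟩
    rw [h₃, ModuleCat.hom_sub, LinearMap.sub_apply, ModuleCat.hom_comp, ModuleCat.hom_comp,
      LinearMap.comp_apply, LinearMap.comp_apply, hz₁, hz₂, map_zero, map_zero, sub_zero]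

/-- The rank form of the Mayer–Vietoris sequence. -/
theorem bettiRank_mayerVietoris {U V : Set W} (hU : IsOpen U) (hV : IsOpen V) (k : ℕ) :
    bettiRank ↥(U ∪ V) k + bettiRank ↥(U ∩ V) k =
      bettiRank U k + bettiRank V k + interKerRank U V k +
        (match k with | 0 => 0 | k + 1 => interKerRank U V k) := by
  classical
  let i := singularChainMap (inclusionMap (Set.inter_subset_left : U ∩ V ⊆ U))
  let j := singularChainMap (inclusionMap (Set.inter_subset_right : U ∩ V ⊆ V))
  let p := singularChainMap (inclusionMap (Set.subset_union_left : U ⊆ U ∪ V))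
  let q := singularChainMap (inclusionMap (Set.subset_union_right : V ⊆ U ∪ V))
  have hij : i ≫ p = j ≫ q := by
    rw [← singularChainMap_comp, ← singularChainMap_comp]; rfl
  let f := biprod.lift i (-j)
  let g := biprod.desc p q
  have w : f ≫ g = 0 := by simp [f, g, hij]
  let P := singularChainComplex U ⊞ singularChainComplex V
  let fs : P ⟶ singularChainComplex U := biprod.fst
  let sn : P ⟶ singularChainComplex V := biprod.snd
  let il : singularChainComplex U ⟶ P := biprod.inl
  let ir : singularChainComplex V ⟶ P := biprod.inr
  have hfi (k x) : fs.f k (f.f k x) = i.f k x :=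
    congr($(biprod.lift_fst i (-j)).f k x)
  have hfj (k x) : sn.f k (f.f k x) = - j.f k x :=
    congr($(biprod.lift_snd i (-j)).f k x)
  have hgl (k x) : g.f k (il.f k x) = p.f k x := congr($(biprod.inl_desc p q).f k x)
  have hgr (k x) : g.f k (ir.f k x) = q.f k x := congr($(biprod.inr_desc p q).f k x)
  have htot (k) (x : P.X k) : il.f k (fs.f k x) + ir.f k (sn.f k x) = x :=
    congr($(biprod.total (X := singularChainComplex U) (Y := singularChainComplex V)).f k x)
  have hginv (k) (x : P.X k) : g.f k x = p.f k (fs.f k x) + q.f k (sn.f k x) := by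
    rw [← hgl, ← hgr, ← map_add, htot]
  have hpi (k x) : p.f k (i.f k x) = q.f k (j.f k x) := congr($(hij).f k x)
  let U' : Set ↥(U ∪ V) := Subtype.val ⁻¹' U
  let V' : Set ↥(U ∪ V) := Subtype.val ⁻¹' V
  have hU' : IsOpen U' := hU.preimage continuous_subtype_val
  have hV' : IsOpen V' := hV.preimage continuous_subtype_val
  have hUV' : U' ∪ V' = Set.univ := Set.eq_univ_of_forall fun x ↦ x.2
  have hsmall (k) (c : (singularChainComplex ↥(U ∪ V)).X k)
      (hc : singularChainEquiv _ k c ∈ SingChain.small U' V' k) :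
      c ∈ LinearMap.range (g.f k).hom := by
    rw [← (singularChainEquiv _ k).symm_apply_apply c]
    refine Finsupp.apply_mem_of_mem_supported (singularChainEquiv _ k).symm.toLinearMap
      (fun σ hσ ↦ ?_) hc
    rcases hσ with hσ | hσ
    · obtain ⟨b, hb⟩ := mem_range_singularChainMap_inclusionMap
        (Set.subset_union_left : U ⊆ U ∪ V) ((singularChainEquiv _ k).symm (Finsupp.single σ 1)) (by
          rw [LinearEquiv.apply_symm_apply]
          intro τ hτ t
          rw [Finset.mem_singleton.mp (Finsupp.support_single_subset hτ)]
          exact hσ ⟨t, rfl⟩)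
      exact ⟨il.f k b, (hgl k b).trans hb⟩
    · obtain ⟨b, hb⟩ := mem_range_singularChainMap_inclusionMap
        (Set.subset_union_right : V ⊆ U ∪ V)
        ((singularChainEquiv _ k).symm (Finsupp.single σ 1)) (by
          rw [LinearEquiv.apply_symm_apply]
          intro τ hτ t
          rw [Finset.mem_singleton.mp (Finsupp.support_single_subset hτ)]
          exact hσ ⟨t, rfl⟩)
      exact ⟨ir.f k b, (hgr k b).trans hb⟩
  have hsmall' (k) (x : P.X k) :
      singularChainEquiv _ k (g.f k x) ∈ SingChain.small U' V' k := by
    rw [hginv, map_add]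
    refine add_mem (fun σ hσ ↦ ?_) (fun σ hσ ↦ ?_)
    · left
      rintro _ ⟨t, rfl⟩
      exact mem_support_singularChainMap_inclusionMap _ _ σ hσ t
    · right
      rintro _ ⟨t, rfl⟩
      exact mem_support_singularChainMap_inclusionMap _ _ σ hσ t
  have key := rank_homology_of_almost_shortExact f g w ?_ ?_ ?_ ?_ k
  · rw [rank_homology_biprod, ker_homologyMap_biprod_lift] at key
    cases k with
    | zero => exact key
    | succ k =>
      rw [prevKerRank, ker_homologyMap_biprod_lift] at key
      exact key
  · intro k x y hxy
    apply singularChainMap_inclusionMap_injective (Set.inter_subset_left : U ∩ V ⊆ U) k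
    exact (hfi k x).symm.trans (congr(fs.f k $hxy).trans (hfi k y))
  · intro k x hx
    rw [hginv, add_eq_zero_iff_eq_neg] at hx
    obtain ⟨y, hy⟩ := mem_range_singularChainMap_inclusionMap
      (Set.inter_subset_left : U ∩ V ⊆ U) (fs.f k x) (by
        intro σ hσ t
        refine ⟨(σ t).2, ?_⟩
        have h := singularChainEquiv_map (inclusionMap (Set.subset_union_left : U ⊆ U ∪ V)) k
          (fs.f k x)
        change singularChainEquiv _ k (p.f k (fs.f k x)) = _ at h
        rw [hx, map_neg] at h
        have h1 : (inclusionMap (Set.subset_union_left : U ⊆ U ∪ V)).comp σ ∈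
            (singularChainEquiv _ k (q.f k (sn.f k x))).support := by
          rw [← Finsupp.support_neg, h, Finsupp.mapDomain_support_of_injective
            (inclusionMap_comp_injective _ _)]
          exact Finset.mem_image_of_mem _ hσ
        exact mem_support_singularChainMap_inclusionMap _ _ _ h1 t)
    refine ⟨y, ?_⟩
    have h1 : fs.f k (f.f k y) = fs.f k x := (hfi k y).trans hy
    have h2 : sn.f k (f.f k y) = sn.f k x := by
      rw [hfj]
      apply singularChainMap_inclusionMap_injective (Set.subset_union_right : V ⊆ U ∪ V) k
      change q.f k _ = q.f k _
      rw [map_neg, ← hpi, neg_eq_iff_eq_neg, ← hx]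
      exact congrArg _ hy
    rw [← htot k (f.f k y), h1, h2, htot]
  · intro c
    exact hsmall 0 c (SingChain.small_zero hUV' _)
  · rintro k c ⟨x, hx⟩
    obtain ⟨e, he⟩ := SingChain.exists_sub_bdry_mem_small hU' hV' hUV'
      (singularChainEquiv _ (k + 1) c) (by
        rw [← singularChainEquiv_d, ← hx]
        exact hsmall' k x)
    refine ⟨(singularChainEquiv _ (k + 2)).symm e, hsmall _ _ ?_⟩
    rwa [map_sub, singularChainEquiv_d, LinearEquiv.apply_symm_apply]
end

section

variable {X Y Z : Type} [TopologicalSpace X] [TopologicalSpace Y] [TopologicalSpace Z]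

lemma singularHomologyMap_id (k : ℕ) :
    singularHomologyMap (ContinuousMap.id X) k = LinearMap.id := by
  rw [singularHomologyMap, singularChainMap_id, HomologicalComplex.homologyMap_id]
  rfl

lemma singularHomologyMap_comp (g : C(Y, Z)) (f : C(X, Y)) (k : ℕ) :
    singularHomologyMap (g.comp f) k = singularHomologyMap g k ∘ₗ singularHomologyMap f k := by
  rw [singularHomologyMap, singularChainMap_comp, HomologicalComplex.homologyMap_comp]
  rfl

lemma ContinuousMap.Homotopic.singularHomologyMap_eq {f g : C(X, Y)} (h : f.Homotopic g) (k : ℕ) :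
    singularHomologyMap f k = singularHomologyMap g k := by
  obtain ⟨H⟩ := h
  let H' : TopCat.Homotopy (TopCat.ofHom f) (TopCat.ofHom g) := H
  exact congrArg ModuleCat.Hom.hom
    ((SimplicialObject.Homotopy.toChainHomotopy
      (H'.toSSet.toSimplicialObjectHomotopy.whiskerRight (ModuleCat.free ℝ))).homologyMap_eq k)

lemma singularHomologyMap_injective_of_comp_homotopic_id {f : C(X, Y)} {g : C(Y, X)}
    (h : (g.comp f).Homotopic (ContinuousMap.id X)) (k : ℕ) :
    Function.Injective (singularHomologyMap f k) := by
  have e := h.singularHomologyMap_eq k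
  rw [singularHomologyMap_comp, singularHomologyMap_id] at e
  exact Function.LeftInverse.injective (g := singularHomologyMap g k) fun x ↦ congr($e x)

lemma singularHomologyMap_surjective_of_comp_homotopic_id {f : C(X, Y)} {g : C(Y, X)}
    (h : (f.comp g).Homotopic (ContinuousMap.id Y)) (k : ℕ) :
    Function.Surjective (singularHomologyMap f k) := by
  have e := h.singularHomologyMap_eq k
  rw [singularHomologyMap_comp, singularHomologyMap_id] at e
  exact Function.RightInverse.surjective (g := singularHomologyMap g k) fun x ↦ congr($e x)

lemma ContinuousMap.HomotopyEquiv.bettiRank_eq (e : ContinuousMap.HomotopyEquiv X Y) (k : ℕ) :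
    bettiRank X k = bettiRank Y k :=
  (LinearEquiv.ofBijective (singularHomologyMap e.toFun k)
    ⟨singularHomologyMap_injective_of_comp_homotopic_id e.left_inv k,
      singularHomologyMap_surjective_of_comp_homotopic_id e.right_inv k⟩).rank_eq

lemma Homeomorph.bettiRank_eq (e : X ≃ₜ Y) (k : ℕ) : bettiRank X k = bettiRank Y k :=
  e.toHomotopyEquiv.bettiRank_eq k

lemma bettiRank_of_isEmpty [IsEmpty X] (k : ℕ) : bettiRank X k = 0 := by
  have h : Subsingleton ((singularChainComplex X).X k) := by
    have : IsEmpty C(stdSimplex ℝ (Fin (k + 1)), X) :=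
      ⟨fun σ ↦ isEmptyElim (σ (stdSimplex.vertex 0))⟩
    exact (singularChainEquiv X k).toEquiv.subsingleton
  have h' : (singularChainComplex X).ExactAt k :=
    ShortComplex.exact_of_isZero_X₂ _ (@ModuleCat.isZero_of_subsingleton ℝ _ _ h)
  have := ModuleCat.subsingleton_of_isZero h'.isZero_homology
  exact rank_subsingleton' ℝ _

lemma bettiRank_unit (k : ℕ) : bettiRank Unit k = if k = 0 then 1 else 0 := by
  let e : singularChainComplex Unit ≅
      ChainComplex.alternatingConst.obj ((ModuleCat.free ℝ).obj Unit) :=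
    (AlgebraicTopology.alternatingFaceMapComplex _).mapIso
    (((SimplicialObject.whiskering _ _).obj _).mapIso
    (TopCat.toSSetIsoConst (TopCat.of Unit)) ≪≫ Functor.constComp _ _ _) ≪≫
    AlgebraicTopology.alternatingFaceMapComplexConst.app _
  split_ifs with h
  · subst h
    have e' := (HomologicalComplex.homologyFunctor _ _ 0).mapIso e ≪≫
      ChainComplex.alternatingConstHomologyZero _
    refine e'.toLinearEquiv.rank_eq.trans ?_
    exact (rank_finsupp_self' (R := ℝ) (ι := Unit)).trans (by simp)
  · have := ModuleCat.subsingleton_of_isZero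
      ((ChainComplex.alternatingConst_exactAt ((ModuleCat.free ℝ).obj Unit) k h).of_iso
        e.symm).isZero_homology
    exact rank_subsingleton' ℝ _

lemma bettiRank_of_contractible [ContractibleSpace X] (k : ℕ) :
    bettiRank X k = if k = 0 then 1 else 0 := by
  obtain ⟨e⟩ := ContractibleSpace.hequiv_unit X
  rw [e.bettiRank_eq, bettiRank_unit]

/-- Two continuous maps to a subset of `B × E` are homotopic if they agree in the first coordinate
and the segments between their second coordinates lie in the subset. -/
lemma ContinuousMap.homotopic_of_segment_subset {B E : Type} [TopologicalSpace B] [AddCommGroup E]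
    [Module ℝ E] [TopologicalSpace E] [IsTopologicalAddGroup E] [ContinuousSMul ℝ E]
    {S : Set (B × E)} (f g : C(Z, S)) (h : ∀ z, (g z : B × E).1 = (f z : B × E).1)
    (h' : ∀ z (a b : ℝ), 0 ≤ a → 0 ≤ b → a + b = 1 →
      ((f z : B × E).1, a • (f z : B × E).2 + b • (g z : B × E).2) ∈ S) :
    f.Homotopic g :=
  ⟨{ toFun := fun p ↦ ⟨((f p.2 : B × E).1,
        (1 - (p.1 : ℝ)) • (f p.2 : B × E).2 + (p.1 : ℝ) • (g p.2 : B × E).2),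
        h' p.2 (1 - p.1) p.1 (by linarith [p.1.2.2]) p.1.2.1 (by ring)⟩
     continuous_toFun := by fun_prop
     map_zero_left := fun z ↦ by ext <;> simp
     map_one_left := fun z ↦ by ext <;> simp [h] }⟩
end

section

/-- The product of `B` with the space `E` punctured at the origin. -/
def prodPunctured (B E : Type) [Zero E] : Set (B × E) := {p | p.2 ≠ 0}

/-- The part of the punctured `E × ℝ` where `0 < ε * t` off the last coordinate axis. -/
def prodPuncturedHalf (B E : Type) [Zero E] (ε : ℝ) : Set (B × (E × ℝ)) :=
  {p | p.2.1 ≠ 0 ∨ 0 < ε * p.2.2}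

lemma prodPuncturedHalf_union {B E : Type} [Zero E] :
    prodPuncturedHalf B E 1 ∪ prodPuncturedHalf B E (-1) = prodPunctured B (E × ℝ) := by
  ext ⟨b, e, t⟩
  change (e ≠ 0 ∨ 0 < 1 * t) ∨ (e ≠ 0 ∨ 0 < -1 * t) ↔ (e, t) ≠ 0
  rw [ne_eq (e, t), Prod.mk_eq_zero, not_and_or, ← ne_eq t, ne_iff_lt_or_gt (a := t), one_mul,
    neg_one_mul,
    neg_pos]
  tauto

lemma prodPuncturedHalf_inter {B E : Type} [Zero E] :
    prodPuncturedHalf B E 1 ∩ prodPuncturedHalf B E (-1) = {p | p.2.1 ≠ 0} := by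
  ext ⟨b, e, t⟩
  change (e ≠ 0 ∨ 0 < 1 * t) ∧ (e ≠ 0 ∨ 0 < -1 * t) ↔ e ≠ 0
  rw [← or_and_left, or_iff_left]
  rintro ⟨h₁, h₂⟩
  linarith

variable {B E : Type} [TopologicalSpace B] [NormedAddCommGroup E]

lemma isOpen_prodPuncturedHalf (ε : ℝ) : IsOpen (prodPuncturedHalf B E ε) :=
  (isOpen_ne_fun (f := fun p : B × (E × ℝ) ↦ p.2.1) (by fun_prop) continuous_const).union
    (isOpen_lt (g := fun p : B × (E × ℝ) ↦ ε * p.2.2) continuous_const (by fun_prop))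

lemma interKerRank_prodPuncturedHalf_of_subsingleton [Subsingleton E] (k : ℕ) :
    interKerRank (prodPuncturedHalf B E 1) (prodPuncturedHalf B E (-1)) k = 0 := by
  have : IsEmpty ↥(prodPuncturedHalf B E 1 ∩ prodPuncturedHalf B E (-1)) := by
    rw [prodPuncturedHalf_inter]
    exact ⟨fun p ↦ p.2 (Subsingleton.elim _ _)⟩
  have h := bettiRank_of_isEmpty (X := ↥(prodPuncturedHalf B E 1 ∩ prodPuncturedHalf B E (-1))) k
  rw [interKerRank]
  exact le_antisymm ((Submodule.rank_le _).trans h.le) zero_le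

variable [NormedSpace ℝ E]

/-- The projection of a half of the punctured space to the base is a homotopy equivalence. -/
noncomputable def prodPuncturedHalfEquiv {ε : ℝ} (hε : ε * ε = 1) :
    ContinuousMap.HomotopyEquiv (prodPuncturedHalf B E ε) B where
  toFun := ⟨fun p ↦ p.1.1, by fun_prop⟩
  invFun := ⟨fun b ↦ ⟨(b, 0, ε), Or.inr (by simp [hε])⟩, by fun_prop⟩
  left_inv := by
    refine ContinuousMap.homotopic_of_segment_subset _ _ (fun _ ↦ rfl) ?_
    rintro ⟨⟨x, e, t⟩, h⟩ a b ha hb hab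
    change a • (0 : E) + b • e ≠ 0 ∨ 0 < ε * (a * ε + b * t)
    have h' : ε * (a * ε + b * t) = a + b * (ε * t) := by linear_combination a * hε
    rw [h', smul_zero, zero_add]
    rcases hb.eq_or_lt with rfl | hb'
    · right
      linarith
    · refine h.imp (smul_ne_zero hb'.ne') fun h ↦ ?_
      have := mul_pos hb' h
      linarith
  right_inv := .refl _

/-- The overlap of the two halves is the punctured `E` up to homotopy. -/
noncomputable def prodPuncturedEquiv :
    ContinuousMap.HomotopyEquiv ↥({p : B × (E × ℝ) | p.2.1 ≠ 0}) (prodPunctured B E) where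
  toFun := ⟨fun p ↦ ⟨(p.1.1, p.1.2.1), p.2⟩, by fun_prop⟩
  invFun := ⟨fun p ↦ ⟨(p.1.1, p.1.2, 0), p.2⟩, by fun_prop⟩
  left_inv := by
    refine ContinuousMap.homotopic_of_segment_subset _ _ (fun _ ↦ rfl) ?_
    rintro ⟨⟨x, e, t⟩, h⟩ a b ha hb hab
    change a • e + b • e ≠ 0
    rwa [← add_smul, hab, one_smul]
  right_inv := .refl _

lemma interKerRank_prodPuncturedHalf (k : ℕ) :
    interKerRank (prodPuncturedHalf B E 1) (prodPuncturedHalf B E (-1)) k =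
      Module.rank ℝ (LinearMap.ker (singularHomologyMap
        (⟨fun p ↦ p.1.1, by fun_prop⟩ :
          C(↥(prodPuncturedHalf B E 1 ∩ prodPuncturedHalf B E (-1)), B)) k)) := by
  have h {ε : ℝ} (hε : ε * ε = 1) (hs : prodPuncturedHalf B E 1 ∩ prodPuncturedHalf B E (-1) ⊆
      prodPuncturedHalf B E ε) :
      LinearMap.ker (singularHomologyMap (inclusionMap hs) k) =
      LinearMap.ker (singularHomologyMap
        (⟨fun p ↦ p.1.1, by fun_prop⟩ :
          C(↥(prodPuncturedHalf B E 1 ∩ prodPuncturedHalf B E (-1)), B)) k) := by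
    have e : (⟨fun p ↦ p.1.1, by fun_prop⟩ :
          C(↥(prodPuncturedHalf B E 1 ∩ prodPuncturedHalf B E (-1)), B)) =
        (prodPuncturedHalfEquiv hε).toFun.comp (inclusionMap hs) := rfl
    rw [e, singularHomologyMap_comp, LinearMap.ker_comp_of_ker_eq_bot]
    exact LinearMap.ker_eq_bot.mpr
      (singularHomologyMap_injective_of_comp_homotopic_id (prodPuncturedHalfEquiv hε).left_inv k)
  rw [interKerRank, h (by norm_num), h (by norm_num), inf_idem]

lemma bettiRank_prodPunctured_prod (k : ℕ) :
    bettiRank (prodPunctured B (E × ℝ)) k + bettiRank (prodPunctured B E) k =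
      bettiRank B k + bettiRank B k +
        interKerRank (prodPuncturedHalf B E 1) (prodPuncturedHalf B E (-1)) k +
        (match k with
          | 0 => 0
          | k + 1 => interKerRank (prodPuncturedHalf B E 1) (prodPuncturedHalf B E (-1)) k) := by
  have h := bettiRank_mayerVietoris (isOpen_prodPuncturedHalf (B := B) (E := E) 1)
    (isOpen_prodPuncturedHalf (-1)) k
  rw [prodPuncturedHalf_union, (prodPuncturedHalfEquiv (by norm_num)).bettiRank_eq,
    (prodPuncturedHalfEquiv (by norm_num)).bettiRank_eq] at h
  rw [← (prodPuncturedEquiv (B := B) (E := E)).bettiRank_eq, ← prodPuncturedHalf_inter]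
  exact h

lemma interKerRank_prodPuncturedHalf_add [Nontrivial E] (k : ℕ) :
    bettiRank B k + interKerRank (prodPuncturedHalf B E 1) (prodPuncturedHalf B E (-1)) k =
      bettiRank (prodPunctured B E) k := by
  obtain ⟨e, he⟩ := exists_ne (0 : E)
  let f : C(↥(prodPuncturedHalf B E 1 ∩ prodPuncturedHalf B E (-1)), B) :=
    ⟨fun p ↦ p.1.1, by fun_prop⟩
  let s : C(B, ↥(prodPuncturedHalf B E 1 ∩ prodPuncturedHalf B E (-1))) :=
    ⟨fun b ↦ ⟨(b, e, 0), Or.inl he, Or.inl he⟩, by fun_prop⟩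
  have hf : Function.Surjective (singularHomologyMap f k) :=
    singularHomologyMap_surjective_of_comp_homotopic_id (g := s) (.refl _) k
  have h := LinearMap.rank_range_add_rank_ker (singularHomologyMap f k)
  rw [LinearMap.range_eq_top.mpr hf, rank_top] at h
  rw [interKerRank_prodPuncturedHalf, ← prodPuncturedEquiv.bettiRank_eq, ← prodPuncturedHalf_inter]
  exact h

/-- A continuous linear equivalence induces a homeomorphism of punctured spaces. -/
def prodPuncturedCongr {E' : Type} [NormedAddCommGroup E'] [NormedSpace ℝ E'] (e : E ≃L[ℝ] E') :
    prodPunctured B E ≃ₜ prodPunctured B E' :=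
  ((Homeomorph.refl B).prodCongr e.toHomeomorph).subtype fun p ↦ by simp [prodPunctured]

/-- The homology of the product of `B` with a punctured `(m + 1)`-dimensional space, that is, of
`B × S ^ m` up to homotopy. -/
theorem bettiRank_prodPunctured {b : ℕ → ℕ} (hb : ∀ k, bettiRank B k = b k) (m : ℕ)
    (E : Type) [NormedAddCommGroup E] [NormedSpace ℝ E] (hE : Module.finrank ℝ E = m + 1) (k : ℕ) :
    bettiRank (prodPunctured B E) k = (b k + if m ≤ k then b (k - m) else 0 : ℕ) := by
  induction m generalizing E k with
  | zero =>
    have : FiniteDimensional ℝ E := .of_finrank_pos (by lia)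
    let e : E ≃L[ℝ] (Fin 0 → ℝ) × ℝ := .ofFinrankEq (by simp [hE])
    have h := bettiRank_prodPunctured_prod (B := B) (E := Fin 0 → ℝ) k
    have : IsEmpty (prodPunctured B (Fin 0 → ℝ)) := ⟨fun p ↦ p.2 (Subsingleton.elim _ _)⟩
    rw [bettiRank_of_isEmpty (X := prodPunctured B (Fin 0 → ℝ)), hb] at h
    rw [(prodPuncturedCongr e).bettiRank_eq]
    cases k <;> simpa [interKerRank_prodPuncturedHalf_of_subsingleton] using h
  | succ m ih =>
    have : FiniteDimensional ℝ E := .of_finrank_pos (by lia)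
    let e : E ≃L[ℝ] (Fin (m + 1) → ℝ) × ℝ := .ofFinrankEq (by simp [hE])
    have h := bettiRank_prodPunctured_prod (B := B) (E := Fin (m + 1) → ℝ) k
    have ih := ih (Fin (m + 1) → ℝ) (by simp)
    have hκ (k : ℕ) : interKerRank (prodPuncturedHalf B (Fin (m + 1) → ℝ) 1)
        (prodPuncturedHalf B (Fin (m + 1) → ℝ) (-1)) k = (if m ≤ k then b (k - m) else 0 : ℕ) := by
      have h := interKerRank_prodPuncturedHalf_add (B := B) (E := Fin (m + 1) → ℝ) k
      rw [ih, hb, Nat.cast_add] at h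
      exact Cardinal.eq_of_add_eq_add_left h (Cardinal.natCast_lt_aleph0)
    rw [(prodPuncturedCongr e).bettiRank_eq]
    rw [ih, hb] at h
    refine Cardinal.eq_of_add_eq_add_right (h.trans ?_) Cardinal.natCast_lt_aleph0
    cases k with
    | zero =>
      rw [hκ]
      norm_cast
      simp; ring
    | succ k =>
      dsimp only
      rw [hκ, hκ]
      norm_cast
      simp only [Nat.add_le_add_iff_right, Nat.add_sub_add_right]
      ring
end

section

/-- The ordered configuration space of `r` points. -/
abbrev OrdConf (r : ℕ) (E : Type) : Type := {x : Fin r → E // Function.Injective x}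

namespace OrdConf

/-- Configurations with an additional point, distinct from the first `s` points. -/
def away (r : ℕ) (E : Type) (s : ℕ) : Set (OrdConf r E × E) :=
  {p | ∀ j : Fin r, (j : ℕ) < s → p.2 ≠ p.1.1 j}

/-- Configurations with an additional point, closer to the `i`-th point than all previous
points. -/
def near {r : ℕ} (E : Type) [NormedAddCommGroup E] (i : Fin r) : Set (OrdConf r E × E) :=
  {p | ∀ j < i, ‖p.2 - p.1.1 i‖ < ‖p.1.1 j - p.1.1 i‖}

@[fun_prop]
lemma continuous_point {r : ℕ} {E : Type} [TopologicalSpace E] {Z : Type*} [TopologicalSpace Z]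
    {f : Z → OrdConf r E} (hf : Continuous f) (j : Fin r) : Continuous fun z ↦ (f z).1 j :=
  (continuous_apply j).comp (continuous_subtype_val.comp hf)

variable {r : ℕ} {E : Type} [NormedAddCommGroup E]

lemma isOpen_away (s : ℕ) : IsOpen (away r E s) := by
  simp only [away, Set.ofPred_forall]
  exact isOpen_iInter_of_finite fun j ↦ isOpen_iInter_of_finite fun _ ↦
    isOpen_ne_fun (by fun_prop) (by fun_prop)

lemma isOpen_near (i : Fin r) : IsOpen (near E i) := by
  simp only [near, Set.ofPred_forall]
  exact isOpen_iInter_of_finite fun j ↦ isOpen_iInter_of_finite fun _ ↦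
    isOpen_lt (by fun_prop) (by fun_prop)

lemma away_union_near (i : Fin r) : away r E (i + 1) ∪ near E i = away r E i := by
  ext ⟨x, y⟩
  constructor
  · rintro (h | h) j hj
    · exact h j (by lia)
    · intro hy
      have := h j hj
      rw [← show y = x.1 j from hy] at this
      exact lt_irrefl _ this
  · intro h
    by_cases hy : y = x.1 i
    · right
      intro j hj
      simpa [hy, sub_eq_zero] using x.2.ne hj.ne
    · left
      intro j hj
      rcases (Nat.lt_succ_iff.mp hj).eq_or_lt with hj | hj
      · rwa [Fin.ext hj]
      · exact h j hj

/-- Configurations with an additional point, distinct from all others, are configurations with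
one more point. -/
def awayHomeomorph : away r E r ≃ₜ OrdConf (r + 1) E where
  toFun p := ⟨Fin.cons p.1.2 p.1.1.1, Fin.cons_injective_iff.mpr
    ⟨fun ⟨j, hj⟩ ↦ p.2 j j.2 hj.symm, p.1.1.2⟩⟩
  invFun x := ⟨(⟨fun j ↦ x.1 j.succ, x.2.comp (Fin.succ_injective r)⟩, x.1 0),
    fun j _ ↦ x.2.ne (Fin.succ_ne_zero j).symm⟩
  left_inv _ := rfl
  right_inv x := Subtype.ext (Fin.cons_self_tail x.1)
  continuous_toFun := by
    refine Continuous.subtype_mk (continuous_pi fun j ↦ ?_) _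
    refine Fin.cases ?_ (fun j ↦ ?_) j
    · simp only [Fin.cons_zero]; fun_prop
    · simp only [Fin.cons_succ]; fun_prop
  continuous_invFun := by fun_prop

/-- A positive lower bound, continuous in the configuration, of the distances from the `i`-th
point to the previous points. -/
noncomputable def radius (i : Fin r) (x : OrdConf r E) : ℝ :=
  (1 + ∑ j with j < i, ‖x.1 j - x.1 i‖⁻¹)⁻¹

lemma radius_inv_pos (i : Fin r) (x : OrdConf r E) :
    0 < 1 + ∑ j with j < i, ‖x.1 j - x.1 i‖⁻¹ := by positivity

lemma radius_pos (i : Fin r) (x : OrdConf r E) : 0 < radius i x :=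
  inv_pos.mpr (radius_inv_pos i x)

lemma radius_le_one (i : Fin r) (x : OrdConf r E) : radius i x ≤ 1 :=
  inv_le_one_of_one_le₀ (le_add_of_nonneg_right (by positivity))

lemma radius_le {i j : Fin r} (hj : j < i) (x : OrdConf r E) :
    radius i x ≤ ‖x.1 j - x.1 i‖ := by
  have hx : 0 < ‖x.1 j - x.1 i‖ := norm_pos_iff.mpr (sub_ne_zero.mpr (x.2.ne hj.ne))
  refine inv_le_of_inv_le₀ hx ?_
  have := Finset.single_le_sum (f := fun j ↦ ‖x.1 j - x.1 i‖⁻¹) (s := {j | j < i})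
    (fun _ _ ↦ by positivity) (by simpa using hj)
  linarith

lemma continuous_radius (i : Fin r) : Continuous (radius (E := E) i) := by
  refine Continuous.inv₀ (continuous_const.add (continuous_finsetSum _ fun j hj ↦ ?_))
    fun x ↦ (radius_inv_pos i x).ne'
  refine Continuous.inv₀ (by fun_prop) fun x ↦ ?_
  exact norm_ne_zero_iff.mpr (sub_ne_zero.mpr (x.2.ne (by simpa using hj : j < i).ne))

lemma smul_mem_away_inter_near {i : Fin r} {x : OrdConf r E} {y : E}
    (h : y ∈ {y | ∀ j < i, ‖y‖ < ‖x.1 j - x.1 i‖}) (hy : y ≠ 0) :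
    (x, x.1 i + y) ∈ away r E (i + 1) ∩ near E i := by
  have hn : (x, x.1 i + y) ∈ near E i := fun j hj ↦ by simpa using h j hj
  refine ⟨fun j hj ↦ ?_, hn⟩
  rcases (Nat.lt_succ_iff.mp hj).eq_or_lt with hj | hj
  · simpa [Fin.ext hj] using hy
  · exact (away_union_near i).subset (Or.inr hn) j hj

variable [NormedSpace ℝ E]

/-- Nothing is imposed on the additional point, so it can be contracted away. -/
noncomputable def awayZeroEquiv :
    ContinuousMap.HomotopyEquiv (away r E 0) (OrdConf r E) where
  toFun := ⟨fun p ↦ p.1.1, by fun_prop⟩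
  invFun := ⟨fun x ↦ ⟨(x, 0), fun j hj ↦ (Nat.not_lt_zero _ hj).elim⟩, by fun_prop⟩
  left_inv := ContinuousMap.homotopic_of_segment_subset _ _ (fun _ ↦ rfl)
    fun _ _ _ _ _ _ j hj ↦ (Nat.not_lt_zero _ hj).elim
  right_inv := .refl _

/-- The additional point can be contracted to the `i`-th point. -/
noncomputable def nearEquiv (i : Fin r) :
    ContinuousMap.HomotopyEquiv (near E i) (OrdConf r E) where
  toFun := ⟨fun p ↦ p.1.1, by fun_prop⟩
  invFun := ⟨fun x ↦ ⟨(x, x.1 i), fun j hj ↦ by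
    simpa [sub_eq_zero] using x.2.ne hj.ne⟩, by fun_prop⟩
  left_inv := by
    refine ContinuousMap.homotopic_of_segment_subset _ _ (fun _ ↦ rfl) ?_
    rintro ⟨⟨x, y⟩, h⟩ a b ha hb hab j hj
    change ‖a • x.1 i + b • y - x.1 i‖ < ‖x.1 j - x.1 i‖
    have e : a • x.1 i + b • y - x.1 i = b • (y - x.1 i) := by
      obtain rfl : a = 1 - b := by linarith
      module
    rw [e, norm_smul, Real.norm_of_nonneg hb]
    exact (mul_le_of_le_one_left (norm_nonneg _) (by linarith)).trans_lt (h j hj)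
  right_inv := .refl _

/-- The displacement from the `i`-th point to the additional point. -/
def displacement (i : Fin r) : C(away r E (i + 1), prodPunctured (OrdConf r E) E) :=
  ⟨fun p ↦ ⟨(p.1.1, p.1.2 - p.1.1.1 i), sub_ne_zero.mpr (p.2 i (Nat.lt_succ_self _))⟩,
    by fun_prop⟩

/-- The overlap is the product with a punctured space, up to homotopy. -/
noncomputable def interEquiv (i : Fin r) :
    ContinuousMap.HomotopyEquiv ↥(away r E (i + 1) ∩ near E i)
      (prodPunctured (OrdConf r E) E) where
  toFun := (displacement i).comp (inclusionMap Set.inter_subset_left)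
  invFun := ⟨fun p ↦ ⟨(p.1.1, p.1.1.1 i + (radius i p.1.1 / (1 + ‖p.1.2‖)) • p.1.2), by
      obtain ⟨⟨x, v⟩, hv⟩ := p
      have hr := radius_pos i x
      have hc : 0 < radius i x / (1 + ‖v‖) := by positivity
      refine smul_mem_away_inter_near (fun j hj ↦ ?_) (smul_ne_zero hc.ne' hv)
      refine lt_of_lt_of_le ?_ (radius_le hj x)
      rw [norm_smul, Real.norm_of_nonneg hc.le, div_mul_eq_mul_div, div_lt_iff₀ (by positivity)]
      dsimp only
      linarith⟩, by
    have := continuous_radius (E := E) i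
    refine Continuous.subtype_mk (Continuous.prodMk (by fun_prop) (Continuous.add (by fun_prop)
      (Continuous.smul (Continuous.div (by fun_prop) (by fun_prop) fun p ↦ ?_) (by fun_prop)))) _
    positivity⟩
  left_inv := by
    refine ContinuousMap.homotopic_of_segment_subset _ _ (fun _ ↦ rfl) ?_
    rintro ⟨⟨x, y⟩, h⟩ a b ha hb hab
    change (x, a • (x.1 i + (radius i x / (1 + ‖y - x.1 i‖)) • (y - x.1 i)) + b • y) ∈ _
    set c := radius i x / (1 + ‖y - x.1 i‖) with hc
    have hr := radius_pos i x
    have hc0 : 0 < c := by positivity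
    have hc1 : c ≤ 1 := div_le_one_of_le₀
      ((radius_le_one i x).trans (le_add_of_nonneg_right (norm_nonneg _))) (by positivity)
    have e : a • (x.1 i + c • (y - x.1 i)) + b • y = x.1 i + (a * c + b) • (y - x.1 i) := by
      obtain rfl : a = 1 - b := by linarith
      module
    have hs0 : 0 < a * c + b := by
      rcases hb.eq_or_lt with rfl | hb
      · simpa [show a = 1 by linarith] using hc0
      · positivity
    have hs1 : a * c + b ≤ 1 := by nlinarith
    rw [e]
    refine smul_mem_away_inter_near (fun j hj ↦ ?_)
      (smul_ne_zero hs0.ne' (sub_ne_zero.mpr (h.1 i (Nat.lt_succ_self _))))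
    rw [norm_smul, Real.norm_of_nonneg hs0.le]
    exact (mul_le_of_le_one_left (norm_nonneg _) hs1).trans_lt (h.2 j hj)
  right_inv := by
    refine ContinuousMap.homotopic_of_segment_subset _ _ (fun _ ↦ rfl) ?_
    rintro ⟨⟨x, v⟩, h⟩ a b ha hb hab
    change a • (x.1 i + (radius i x / (1 + ‖v‖)) • v - x.1 i) + b • v ≠ 0
    have hr := radius_pos i x
    have hc0 : 0 < radius i x / (1 + ‖v‖) := by positivity
    rw [add_sub_cancel_left, smul_smul, ← add_smul]
    refine smul_ne_zero ?_ h
    rcases hb.eq_or_lt with rfl | hb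
    · simpa [show a = 1 by linarith] using hc0.ne'
    · positivity

lemma interKerRank_away_near (i : Fin r) (k : ℕ) :
    interKerRank (away r E (i + 1)) (near E i) k = 0 := by
  have h := singularHomologyMap_injective_of_comp_homotopic_id (interEquiv (E := E) i).left_inv k
  have e : (interEquiv (E := E) i).toFun =
    (displacement i).comp (inclusionMap Set.inter_subset_left) := rfl
  rw [e, singularHomologyMap_comp, LinearMap.coe_comp] at h
  rw [interKerRank, LinearMap.ker_eq_bot.mpr h.of_comp, bot_inf_eq, rank_bot]

lemma bettiRank_away_add (i : Fin r) (k : ℕ) :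
    bettiRank (away r E i) k + bettiRank (prodPunctured (OrdConf r E) E) k =
      bettiRank (away r E (i + 1)) k + bettiRank (OrdConf r E) k := by
  have h := bettiRank_mayerVietoris (isOpen_away (E := E) (i + 1)) (isOpen_near i) k
  rw [away_union_near, (interEquiv i).bettiRank_eq, (nearEquiv i).bettiRank_eq,
    interKerRank_away_near] at h
  rw [h]
  cases k <;> simp [interKerRank_away_near]

variable {m : ℕ}

lemma bettiRank_away (hE : Module.finrank ℝ E = m + 1) {b : ℕ → ℕ}
    (hb : ∀ k, bettiRank (OrdConf r E) k = b k) (s : ℕ) (hs : s ≤ r) (k : ℕ) :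
    bettiRank (away r E s) k = (b k + s * if m ≤ k then b (k - m) else 0 : ℕ) := by
  induction s with
  | zero => simp [awayZeroEquiv.bettiRank_eq, hb]
  | succ s ih =>
    have h := bettiRank_away_add (E := E) (⟨s, hs⟩ : Fin r) k
    rw [ih (by lia), bettiRank_prodPunctured hb m E hE, hb] at h
    refine Cardinal.eq_of_add_eq_add_right (h.symm.trans ?_) Cardinal.natCast_lt_aleph0
    norm_cast
    ring

lemma bettiRank_succ (hE : Module.finrank ℝ E = m + 1) {b : ℕ → ℕ}
    (hb : ∀ k, bettiRank (OrdConf r E) k = b k) (k : ℕ) :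
    bettiRank (OrdConf (r + 1) E) k = (b k + r * if m ≤ k then b (k - m) else 0 : ℕ) := by
  rw [← awayHomeomorph.bettiRank_eq, bettiRank_away hE hb r le_rfl]

open Polynomial in
theorem bettiRank_eq_coeff (hE : Module.finrank ℝ E = m + 1) (r k : ℕ) :
    bettiRank (OrdConf r E) k =
      ((∏ j ∈ Finset.range (r - 1), (1 + (j + 1 : ℕ) • (X : ℕ[X]) ^ m)).coeff k : Cardinal) := by
  have h₀ (k : ℕ) : bettiRank (OrdConf 0 E) k = (if k = 0 then 1 else 0 : ℕ) := by
    have : Unique (OrdConf 0 E) :=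
      { default := ⟨Fin.elim0, Function.injective_of_subsingleton _⟩
        uniq := fun _ ↦ Subtype.ext (Subsingleton.elim _ _) }
    rw [bettiRank_of_contractible]
    split_ifs <;> simp
  induction r generalizing k with
  | zero => simpa [Polynomial.coeff_one] using h₀ k
  | succ r ih =>
    rw [bettiRank_succ hE ih]
    rcases r with - | r
    · simp
    · rw [Nat.add_sub_cancel, Nat.add_sub_cancel, Finset.prod_range_succ]
      norm_cast
      rw [mul_add, mul_one, coeff_add, mul_smul_comm, coeff_smul, coeff_mul_X_pow', smul_eq_mul]

end OrdConf
end

open Polynomial in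
lemma eval_one_prod_one_add_smul_X_pow (m s : ℕ) :
    (∏ j ∈ Finset.range s, (1 + (j + 1 : ℕ) • (X : ℕ[X]) ^ m)).eval 1 = (s + 1).factorial := by
  induction s with
  | zero => simp
  | succ s ih =>
    rw [Finset.prod_range_succ, eval_mul, ih, Nat.factorial_succ (s + 1)]
    simp
    ring

/-- The Poincaré polynomial of the ordered configuration space `Conf_r(ℝ^n)`, `n ≥ 2`, is
`∏_{j=1}^{r-1} (1 + j t^{n-1})`; in particular the total dimension of its cohomology is
`r!`. -/
theorem conf_poincare_polynomial (n r : ℕ) (hn : 2 ≤ n) :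
    (∀ k : ℕ,
      bettiRank {x : Fin r → EuclideanSpace ℝ (Fin n) // Function.Injective x} k
        = ((∏ j ∈ Finset.range (r - 1),
            (1 + (j + 1 : ℕ) • (Polynomial.X : Polynomial ℕ) ^ (n - 1))).coeff k
            : Cardinal)) ∧
    (∏ j ∈ Finset.range (r - 1),
        (1 + (j + 1 : ℕ) • (Polynomial.X : Polynomial ℕ) ^ (n - 1))).eval 1
      = r.factorial := by
  refine ⟨OrdConf.bettiRank_eq_coeff (by simp; lia) r, ?_⟩
  rw [eval_one_prod_one_add_smul_X_pow]
  cases r <;> simp
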